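/- arXiv:0806.0304 — 2 statements merged into one kernel-verified Lean document; each statement's English description precedes it below -/
import Mathlib

section
/- The classical Lagrange spectrum is a closed subset of the real numbers. That is, the set Sp_ℚ = { c(x) : x ∈ ℝ \ ℚ } is closed in ℝ, where c(x) = liminf_{p,q ∈ ℤ, q → +∞} |q|² · |x − p/q| is the approximation constant of the irrational number x by rationals. -/
open Filter Topology

namespace LagrangeSpectrum

/-- `S n = [0; a n, a (n + 1), …]` for every `n`. -/
structure IsTail (a : ℕ → ℕ) (S : ℕ → ℝ) : Prop where
  one_le : ∀ n, 1 ≤ a n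
  nonneg : ∀ n, 0 ≤ S n
  eq : ∀ n, S n = 1 / (a n + S (n + 1))

/-- The finite continued fraction `[0; a (n - 1), …, a 0]`. -/
noncomputable def past (a : ℕ → ℕ) : ℕ → ℝ
  | 0 => 0
  | n + 1 => 1 / (a n + past a n)

/-- Numerators of the convergents of `k + [0; a 0, a 1, …]`. -/
def num (a : ℕ → ℕ) (k : ℤ) : ℕ → ℤ
  | 0 => k
  | 1 => a 0 * k + 1
  | n + 2 => a (n + 1) * num a k (n + 1) + num a k n

/-- Denominators of the convergents of `k + [0; a 0, a 1, …]`. -/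
def den (a : ℕ → ℕ) : ℕ → ℤ
  | 0 => 1
  | 1 => a 0
  | n + 2 => a (n + 1) * den a (n + 1) + den a n

/-- The quantity `q_n ^ 2 * |x - p_n / q_n|` for the `n`-th convergent `p_n / q_n` of
`x = k + S 0`, expressed through the two-sided expansion at position `n`. -/
noncomputable def quality (a : ℕ → ℕ) (S : ℕ → ℝ) (n : ℕ) : ℝ :=
  1 / (a n + S (n + 1) + past a n)

lemma abs_one_div_sub_le {a s t k : ℝ} (ha : 1 ≤ a) (hs : 0 ≤ s) (ht : 0 ≤ t) (hk : 0 < k)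
    (h : |s - t| ≤ 1 / k) : |1 / (a + s) - 1 / (a + t)| ≤ 1 / (k + 1) := by
  wlog hst : s ≤ t generalizing s t
  · rw [abs_sub_comm]
    exact this ht hs (by rwa [abs_sub_comm]) (le_of_not_ge hst)
  rw [abs_sub_comm, abs_of_nonneg (by linarith), le_div_iff₀ hk] at h
  have h1 : 1 / (a + s) - 1 / (a + t) = (t - s) / ((a + s) * (a + t)) := by
    field_simp
    ring
  rw [h1, abs_of_nonneg (div_nonneg (by linarith) (by positivity)),
    div_le_div_iff₀ (by positivity) (by positivity)]
  have h2 : 1 + (t - s) ≤ (a + s) * (a + t) := by nlinarith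
  nlinarith

lemma one_div_mem_Icc {a s : ℝ} (ha : 1 ≤ a) (hs : 0 ≤ s) : 1 / (a + s) ∈ Set.Icc (0 : ℝ) 1 :=
  ⟨by positivity, by rw [div_le_one (by positivity)]; linarith⟩

lemma past_mem_Icc {a : ℕ → ℕ} (ha : ∀ n, 1 ≤ a n) (n : ℕ) : past a n ∈ Set.Icc (0 : ℝ) 1 := by
  induction n with
  | zero => simp [past]
  | succ n ih => exact one_div_mem_Icc (by exact_mod_cast ha n) ih.1

lemma IsTail.mem_Icc {a : ℕ → ℕ} {S : ℕ → ℝ} (h : IsTail a S) (n : ℕ) :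
    S n ∈ Set.Icc (0 : ℝ) 1 := by
  rw [h.eq]
  exact one_div_mem_Icc (by exact_mod_cast h.one_le n) (h.nonneg _)

lemma abs_sub_le_one {s t : ℝ} (hs : s ∈ Set.Icc (0 : ℝ) 1) (ht : t ∈ Set.Icc (0 : ℝ) 1) :
    |s - t| ≤ 1 := by
  rw [abs_le]
  constructor <;> linarith [hs.1, hs.2, ht.1, ht.2]

lemma IsTail.abs_sub_le {a b : ℕ → ℕ} {S T : ℕ → ℝ} (hS : IsTail a S) (hT : IsTail b T) (m : ℕ) :
    ∀ n k, (∀ i < m, a (n + i) = b (k + i)) → |S n - T k| ≤ 1 / (m + 1) := by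
  induction m with
  | zero =>
    intro n k _
    simpa using abs_sub_le_one (hS.mem_Icc n) (hT.mem_Icc k)
  | succ m ih =>
    intro n k h
    have h0 : a n = b k := by simpa using h 0 (by omega)
    rw [hS.eq n, hT.eq k, h0]
    push_cast
    refine abs_one_div_sub_le (by exact_mod_cast hT.one_le k) (hS.nonneg _) (hT.nonneg _)
      (by positivity) (ih _ _ fun i hi => ?_)
    simpa [add_assoc, add_comm 1 i] using h (i + 1) (by omega)

lemma abs_past_sub_le {a b : ℕ → ℕ} (ha : ∀ n, 1 ≤ a n) (hb : ∀ n, 1 ≤ b n) (m : ℕ) :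
    ∀ n k, m ≤ n → m ≤ k → (∀ i < m, a (n - 1 - i) = b (k - 1 - i)) →
      |past a n - past b k| ≤ 1 / (m + 1) := by
  induction m with
  | zero =>
    intro n k _ _ _
    simpa using abs_sub_le_one (past_mem_Icc ha n) (past_mem_Icc hb k)
  | succ m ih =>
    intro n k hn hk h
    obtain ⟨n, rfl⟩ : ∃ l, n = l + 1 := ⟨n - 1, by omega⟩
    obtain ⟨k, rfl⟩ : ∃ l, k = l + 1 := ⟨k - 1, by omega⟩
    have h0 : a n = b k := by simpa using h 0 (by omega)
    rw [past, past, h0]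
    push_cast
    refine abs_one_div_sub_le (by exact_mod_cast hb k) (past_mem_Icc ha _).1 (past_mem_Icc hb _).1
      (by positivity) (ih _ _ (by omega) (by omega) fun i hi => ?_)
    have := h (i + 1) (by omega)
    rwa [show n + 1 - 1 - (i + 1) = n - 1 - i by omega,
      show k + 1 - 1 - (i + 1) = k - 1 - i by omega] at this

lemma IsTail.one_le_denom {a : ℕ → ℕ} {S : ℕ → ℝ} (h : IsTail a S) (n : ℕ) :
    (1 : ℝ) ≤ a n + S (n + 1) + past a n := by
  have h1 : (1 : ℝ) ≤ a n := by exact_mod_cast h.one_le n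
  linarith [h.nonneg (n + 1), (past_mem_Icc h.one_le n).1]

lemma IsTail.quality_mem_Icc {a : ℕ → ℕ} {S : ℕ → ℝ} (h : IsTail a S) (n : ℕ) :
    quality a S n ∈ Set.Icc (0 : ℝ) 1 := by
  have := h.one_le_denom n
  exact ⟨by unfold quality; positivity, by
    unfold quality; rw [div_le_one (by positivity)]; exact this⟩

/-- The quality depends continuously on the two-sided sequence of digits. -/
lemma IsTail.abs_quality_sub_le {a b : ℕ → ℕ} {S T : ℕ → ℝ} (hS : IsTail a S) (hT : IsTail b T)
    {m n k : ℕ} (hn : m ≤ n) (hk : m ≤ k) (hr : ∀ i ≤ m, a (n + i) = b (k + i))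
    (hl : ∀ i < m, a (n - 1 - i) = b (k - 1 - i)) :
    |quality a S n - quality b T k| ≤ 2 / (m + 1) := by
  have h0 : a n = b k := by simpa using hr 0 (by omega)
  have h1 := hS.abs_sub_le hT m (n + 1) (k + 1) fun i hi => by
    simpa [add_assoc, add_comm 1 i] using hr (i + 1) (by omega)
  have h2 := abs_past_sub_le hS.one_le hT.one_le m n k hn hk hl
  have h3 := hS.one_le_denom n
  have h4 := hT.one_le_denom k
  unfold quality
  set u := (a n : ℝ) + S (n + 1) + past a n with hu
  set v := (b k : ℝ) + T (k + 1) + past b k with hv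
  have h5 : |v - u| ≤ 2 / (m + 1) := by
    rw [hu, hv, h0, abs_sub_comm,
      show (b k : ℝ) + S (n + 1) + past a n - (b k + T (k + 1) + past b k)
        = (S (n + 1) - T (k + 1)) + (past a n - past b k) by ring]
    refine (abs_add_le _ _).trans ((add_le_add h1 h2).trans (le_of_eq ?_))
    ring
  have h6 : 1 / u - 1 / v = (v - u) / (u * v) := by
    field_simp
  rw [h6, abs_div, abs_of_pos (show 0 < u * v by positivity)]
  exact (div_le_self (abs_nonneg _) (by nlinarith)).trans h5

/-- Depth-`N` truncations of the tails. -/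
noncomputable def truncTail (a : ℕ → ℕ) : ℕ → ℕ → ℝ
  | 0, _ => 0
  | N + 1, n => 1 / (a n + truncTail a N (n + 1))

lemma truncTail_mem_Icc {a : ℕ → ℕ} (ha : ∀ n, 1 ≤ a n) (N n : ℕ) :
    truncTail a N n ∈ Set.Icc (0 : ℝ) 1 := by
  induction N generalizing n with
  | zero => simp [truncTail]
  | succ N ih => exact one_div_mem_Icc (by exact_mod_cast ha n) (ih _).1

lemma abs_truncTail_sub_le {a : ℕ → ℕ} (ha : ∀ n, 1 ≤ a n) (N M n : ℕ) (h : N ≤ M) :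
    |truncTail a N n - truncTail a M n| ≤ 1 / (N + 1) := by
  induction N generalizing n M with
  | zero => simpa using abs_sub_le_one (truncTail_mem_Icc ha 0 n) (truncTail_mem_Icc ha M n)
  | succ N ih =>
    obtain ⟨M, rfl⟩ : ∃ l, M = l + 1 := ⟨M - 1, by omega⟩
    push_cast
    exact abs_one_div_sub_le (by exact_mod_cast ha n) (truncTail_mem_Icc ha _ _).1
      (truncTail_mem_Icc ha _ _).1 (by positivity) (ih _ _ (by omega))

lemma exists_isTail {a : ℕ → ℕ} (ha : ∀ n, 1 ≤ a n) : ∃ S, IsTail a S := by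
  have hc : ∀ n, ∃ s, Tendsto (fun N => truncTail a N n) atTop (𝓝 s) := fun n => by
    refine cauchySeq_tendsto_of_complete
      (cauchySeq_of_le_tendsto_0' (fun N : ℕ => 1 / ((N : ℝ) + 1)) (fun N M h => ?_)
        tendsto_one_div_add_atTop_nhds_zero_nat)
    exact abs_truncTail_sub_le ha N M n h
  choose S hS using hc
  have hS0 : ∀ n, 0 ≤ S n := fun n => ge_of_tendsto' (hS n) fun N => (truncTail_mem_Icc ha N n).1
  refine ⟨S, ha, hS0, fun n => ?_⟩
  have h1 : (1 : ℝ) ≤ a n := by exact_mod_cast ha n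
  refine tendsto_nhds_unique ((hS n).comp (tendsto_add_atTop_nat 1)) ?_
  exact tendsto_const_nhds.div (tendsto_const_nhds.add (hS (n + 1)))
    (by linarith [hS0 (n + 1)])

lemma exists_isTail_of_irrational {x : ℝ} (hx : Irrational x) :
    ∃ (a : ℕ → ℕ) (S : ℕ → ℝ) (k : ℤ), IsTail a S ∧ x = k + S 0 := by
  set S : ℕ → ℝ := fun n => (fun y : ℝ => Int.fract y⁻¹)^[n] (Int.fract x) with hSdef
  have hsucc : ∀ n, S (n + 1) = Int.fract (S n)⁻¹ := fun n => by
    simp only [hSdef, Function.iterate_succ_apply']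
  have hirr : ∀ n, Irrational (S n) := fun n => by
    induction n with
    | zero =>
      change Irrational (x - ⌊x⌋)
      exact hx.sub_intCast _
    | succ n ih =>
      rw [hsucc]
      exact (irrational_inv_iff.2 ih).sub_intCast _
  have hmem : ∀ n, 0 ≤ S n ∧ S n < 1 := fun n => by
    cases n with
    | zero => exact ⟨Int.fract_nonneg _, Int.fract_lt_one _⟩
    | succ n => rw [hsucc]; exact ⟨Int.fract_nonneg _, Int.fract_lt_one _⟩
  have hpos : ∀ n, 0 < S n := fun n => lt_of_le_of_ne (hmem n).1 (hirr n).ne_zero.symm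
  refine ⟨fun n => ⌊(S n)⁻¹⌋₊, S, ⌊x⌋, ⟨fun n => ?_, fun n => (hmem n).1, fun n => ?_⟩, ?_⟩
  · exact Nat.le_floor (by simpa using ((one_lt_inv₀ (hpos n)).2 (hmem n).2).le)
  · rw [hsucc, natCast_floor_eq_intCast_floor (inv_nonneg.2 (hmem n).1), Int.floor_add_fract]
    simp
  · exact (Int.floor_add_fract x).symm

section Convergents

variable {a : ℕ → ℕ} {S : ℕ → ℝ}

lemma den_pos (ha : ∀ n, 1 ≤ a n) (n : ℕ) : 0 < den a n ∧ 0 < den a (n + 1) := by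
  induction n with
  | zero => exact ⟨by simp [den], by simpa [den] using Nat.pos_of_ne_zero (Nat.one_le_iff_ne_zero.1 (ha 0))⟩
  | succ n ih =>
    refine ⟨ih.2, ?_⟩
    rw [den]
    have := ih.1
    have := ih.2
    positivity

lemma le_den (ha : ∀ n, 1 ≤ a n) (n : ℕ) : (n : ℤ) ≤ den a n := by
  have key : ∀ n : ℕ, (n : ℤ) + 1 ≤ den a (n + 1) := fun n => by
    induction n with
    | zero => simpa [den] using ha 0
    | succ n ih =>
      rw [den]
      have h1 := (den_pos ha n).1
      have h2 : (1 : ℤ) ≤ a (n + 1) := by exact_mod_cast ha (n + 1)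
      push_cast
      nlinarith
  cases n with
  | zero => simp [den]
  | succ n => exact_mod_cast key n

lemma den_succ_eq (ha : ∀ n, 1 ≤ a n) (n : ℕ) :
    (den a (n + 1) : ℝ) = den a n * (a n + past a n) := by
  induction n with
  | zero => simp [den, past]
  | succ n ih =>
    have h1 : (1 : ℝ) ≤ a n := by exact_mod_cast ha n
    have h2 := (past_mem_Icc ha n).1
    have h3 : (a n : ℝ) + past a n ≠ 0 := by positivity
    rw [den, past]
    push_cast
    rw [mul_add, ih]
    field_simp

lemma num_mul_den_sub (k : ℤ) (n : ℕ) :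
    num a k (n + 1) * den a n - num a k n * den a (n + 1) = (-1) ^ n := by
  induction n with
  | zero => simp [num, den]; ring
  | succ n ih =>
    rw [num, den, pow_succ, ← ih]
    ring

lemma IsTail.mul_eq_one (h : IsTail a S) (n : ℕ) : S n * (a n + S (n + 1)) = 1 := by
  have h1 : (1 : ℝ) ≤ a n := by exact_mod_cast h.one_le n
  have h2 := h.nonneg (n + 1)
  rw [h.eq n]
  field_simp

lemma IsTail.error_succ (h : IsTail a S) (k : ℤ) (n : ℕ) :
    den a (n + 1) * (k + S 0) - num a k (n + 1)
      = -(den a n * (k + S 0) - num a k n) * S (n + 1) := by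
  induction n with
  | zero =>
    have := h.mul_eq_one 0
    simp only [den, num]
    push_cast
    linear_combination this
  | succ n ih =>
    have h1 := h.mul_eq_one (n + 1)
    rw [den, num]
    push_cast
    linear_combination (-(den a n * (k + S 0) - num a k n : ℝ)) * h1 +
      (a (n + 1) + S (n + 2)) * ih

lemma IsTail.den_mul_abs_error (h : IsTail a S) (k : ℤ) (n : ℕ) :
    den a n * |den a n * (k + S 0) - num a k n| = quality a S n := by
  have hl := h.one_le_denom n
  rw [quality, eq_div_iff (by positivity)]
  induction n with
  | zero =>
    have := h.mul_eq_one 0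
    simp [den, num, past, abs_of_nonneg (h.nonneg 0)]
    simpa using this
  | succ n ih =>
    have h1 := ih (h.one_le_denom n)
    have h2 := h.mul_eq_one (n + 1)
    have h3 := den_succ_eq h.one_le n
    have h4 : (1 : ℝ) ≤ a n := by exact_mod_cast h.one_le n
    have h5 := (past_mem_Icc h.one_le n).1
    have h6 : past a (n + 1) * (a n + past a n) = 1 := by
      rw [past]
      field_simp
    rw [h.error_succ, abs_mul, abs_neg, abs_of_nonneg (h.nonneg (n + 1)), h3, ← h1]
    set e := |(den a n : ℝ) * (k + S 0) - num a k n|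
    linear_combination (den a n * e * (a n + past a n)) * h2 + den a n * e * S (n + 1) * h6

lemma IsTail.abs_error_pos (h : IsTail a S) (k : ℤ) (n : ℕ) :
    0 < |den a n * (k + S 0) - num a k n| := by
  have h1 := h.den_mul_abs_error k n
  have h2 : 0 < quality a S n := by
    have := h.one_le_denom n
    unfold quality
    positivity
  refine abs_pos.2 fun h0 => ?_
  rw [h0] at h1
  simp at h1
  linarith

/-- Convergents are best approximations. -/
lemma IsTail.abs_error_le (h : IsTail a S) (k : ℤ) (n : ℕ) {p q : ℤ} (hq : 0 < q)
    (hqn : q < den a (n + 1)) :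
    |den a n * (k + S 0) - num a k n| ≤ |q * (k + S 0) - p| := by
  obtain ⟨u, v, hu, hv⟩ : ∃ u v : ℤ, q = u * den a n + v * den a (n + 1) ∧
      p = u * num a k n + v * num a k (n + 1) := by
    have hd := num_mul_den_sub (a := a) k n
    have hs : ((-1 : ℤ) ^ n) * (-1) ^ n = 1 := by rw [← mul_pow]; simp
    refine ⟨(-1) ^ n * (q * num a k (n + 1) - p * den a (n + 1)),
      (-1) ^ n * (p * den a n - q * num a k n), ?_, ?_⟩
    · linear_combination (-q) * hs - q * (-1) ^ n * hd
    · linear_combination (-p) * hs - p * (-1) ^ n * hd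
  have he : (q : ℝ) * (k + S 0) - p
      = (den a n * (k + S 0) - num a k n) * (u - v * S (n + 1)) := by
    have := h.error_succ k n
    rw [hu, hv]
    push_cast
    linear_combination (v : ℝ) * this
  rw [he, abs_mul]
  refine le_mul_of_one_le_right (abs_nonneg _) ?_
  have hd0 := (den_pos h.one_le n).1
  have hS := h.nonneg (n + 1)
  rcases lt_trichotomy v 0 with hv0 | hv0 | hv0
  · have hu1 : 1 ≤ u := by
      by_contra! hcon
      nlinarith
    have h1 : (1 : ℝ) ≤ u := by exact_mod_cast hu1
    have h2 : (v : ℝ) ≤ 0 := by exact_mod_cast hv0.le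
    exact le_abs.2 (Or.inl (by nlinarith))
  · have hu1 : 1 ≤ u := by
      by_contra! hcon
      subst hv0
      nlinarith
    have h1 : (1 : ℝ) ≤ u := by exact_mod_cast hu1
    exact le_abs.2 (Or.inl (by rw [hv0]; simpa using h1))
  · have hu1 : u ≤ -1 := by
      by_contra! hcon
      nlinarith
    have h1 : (u : ℝ) ≤ -1 := by exact_mod_cast hu1
    have h2 : (0 : ℝ) ≤ v := by exact_mod_cast hv0.le
    exact le_abs.2 (Or.inr (by nlinarith))

lemma IsTail.irrational (h : IsTail a S) (k : ℤ) : Irrational (k + S 0) := by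
  rintro ⟨r, hr⟩
  have h1 := h.abs_error_le k r.den (p := r.num) (q := r.den) (by exact_mod_cast r.den_pos)
    (by have := le_den h.one_le (r.den + 1); push_cast at this; omega)
  have h2 := h.abs_error_pos k r.den
  rw [← hr] at h1 h2
  have h3 : (r.den : ℝ) * r = r.num := by exact_mod_cast r.den_mul_eq_num
  simp [h3] at h1
  rw [h1] at h2
  simp at h2

lemma exists_den_le_lt (ha : ∀ n, 1 ≤ a n) {q : ℤ} (hq : 0 < q) :
    ∃ n, den a n ≤ q ∧ q < den a (n + 1) := by
  have hex : ∃ n, q < den a n := ⟨q.toNat + 1, by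
    have := le_den ha (q.toNat + 1)
    push_cast at this
    omega⟩
  classical
  have h1 := Nat.find_spec hex
  have h0 : Nat.find hex ≠ 0 := fun h0 => by
    rw [h0] at h1
    simp [den] at h1
    omega
  obtain ⟨n, hn⟩ := Nat.exists_eq_succ_of_ne_zero h0
  refine ⟨n, ?_, ?_⟩
  · exact not_lt.1 (Nat.find_min hex (by omega))
  · rw [hn] at h1
    exact h1

lemma sq_mul_abs_sub_div (x : ℝ) (p : ℤ) {q : ℤ} (hq : 0 < q) :
    |(q : ℝ)| ^ 2 * |x - p / q| = q * |q * x - p| := by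
  have h : (0 : ℝ) < q := by exact_mod_cast hq
  rw [show (q : ℝ) * x - p = q * (x - p / q) by field_simp, abs_mul, abs_of_pos h]
  ring

lemma IsTail.eventually_le_iff (h : IsTail a S) (k : ℤ) (b : ℝ) :
    (∀ᶠ pq : ℤ × ℤ in comap (fun pq : ℤ × ℤ => pq.2) atTop,
      b ≤ |(pq.2 : ℝ)| ^ 2 * |(k + S 0) - (pq.1 : ℝ) / (pq.2 : ℝ)|) ↔
    ∀ᶠ n in atTop, b ≤ quality a S n := by
  constructor
  · intro H
    have hden : Tendsto (den a) atTop atTop :=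
      tendsto_atTop_mono (le_den h.one_le) tendsto_natCast_atTop_atTop
    have ht : Tendsto (fun n => (num a k n, den a n)) atTop
        (comap (fun pq : ℤ × ℤ => pq.2) atTop) := tendsto_comap_iff.2 hden
    filter_upwards [ht.eventually H] with n hn
    rwa [sq_mul_abs_sub_div _ _ (den_pos h.one_le n).1, h.den_mul_abs_error] at hn
  · intro H
    obtain ⟨N, hN⟩ := eventually_atTop.1 H
    have hbig : ∀ᶠ q : ℤ in atTop, 0 < q ∧ ∀ n ∈ Finset.range N, den a (n + 1) ≤ q :=
      (eventually_gt_atTop 0).and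
        ((eventually_all_finset _).2 fun n _ => eventually_ge_atTop _)
    filter_upwards [hbig.comap (fun pq : ℤ × ℤ => pq.2)] with pq hpq
    obtain ⟨hq, hlarge⟩ := hpq
    obtain ⟨n, hn1, hn2⟩ := exists_den_le_lt h.one_le hq
    have hNn : N ≤ n := by
      by_contra! hcon
      exact absurd (hlarge n (Finset.mem_range.2 hcon)) (not_le.2 hn2)
    rw [sq_mul_abs_sub_div _ _ hq]
    refine (hN n hNn).trans ?_
    rw [← h.den_mul_abs_error k n]
    exact mul_le_mul (by exact_mod_cast hn1) (h.abs_error_le k n hq hn2) (abs_nonneg _)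
      (by exact_mod_cast hq.le)

/-- The approximation constant of `k + [0; a 0, a 1, …]` in terms of its digits. -/
lemma IsTail.liminf_eq (h : IsTail a S) (k : ℤ) :
    liminf (fun pq : ℤ × ℤ => |(pq.2 : ℝ)| ^ 2 * |(k + S 0) - (pq.1 : ℝ) / (pq.2 : ℝ)|)
      (comap (fun pq : ℤ × ℤ => pq.2) atTop) = liminf (quality a S) atTop := by
  simp only [Filter.liminf_eq, h.eventually_le_iff]

lemma IsTail.eventually_lt_of_lt_liminf (h : IsTail a S) {b : ℝ}
    (hb : b < liminf (quality a S) atTop) : ∀ᶠ n in atTop, b < quality a S n :=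
  Filter.eventually_lt_of_lt_liminf hb
    (isBoundedUnder_of ⟨0, fun n => (h.quality_mem_Icc n).1⟩)

lemma IsTail.frequently_lt_of_liminf_lt (h : IsTail a S) {b : ℝ}
    (hb : liminf (quality a S) atTop < b) : ∃ᶠ n in atTop, quality a S n < b :=
  Filter.frequently_lt_of_liminf_lt
    (isBoundedUnder_of ⟨1, fun n => (h.quality_mem_Icc n).2⟩ :
      IsBoundedUnder (· ≤ ·) atTop _).isCoboundedUnder_ge hb

lemma IsTail.liminf_quality_eq (h : IsTail a S) {c : ℝ}
    (hlow : ∀ ε > 0, ∀ᶠ n in atTop, c - ε < quality a S n)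
    (hup : ∀ ε > 0, ∃ᶠ n in atTop, quality a S n < c + ε) :
    liminf (quality a S) atTop = c := by
  apply le_antisymm
  · refine le_of_forall_pos_lt_add fun ε hε => ?_
    by_contra! hcon
    have h1 := h.eventually_lt_of_lt_liminf (b := c + ε / 2) (by linarith)
    obtain ⟨n, hn1, hn2⟩ := ((hup (ε / 2) (by linarith)).and_eventually h1).exists
    linarith
  · refine le_of_forall_pos_sub_le fun ε hε => ?_
    by_contra! hcon
    obtain ⟨n, hn1, hn2⟩ :=
      ((h.frequently_lt_of_liminf_lt hcon).and_eventually (hlow ε hε)).exists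
    linarith

end Convergents

lemma exists_eventually_eq_of_le (U : Ultrafilter ℕ) {f : ℕ → ℕ} {A : ℕ}
    (h : ∀ᶠ n in (U : Filter ℕ), f n ≤ A) : ∃ v ≤ A, ∀ᶠ n in (U : Filter ℕ), f n = v := by
  have h1 : (⋃ v ∈ Set.Iic A, {n | f n = v}) ∈ U := by
    refine mem_of_superset h fun n hn => ?_
    simpa using hn
  exact (Ultrafilter.finite_biUnion_mem_iff (Set.finite_Iic A)).1 h1

/-- A family of eventually bounded sequences has a common two-sided limit word. -/
lemma exists_limit_word {a : ℕ → ℕ → ℕ} {A : ℕ} (h : ∀ j, ∀ᶠ n in atTop, a j n ≤ A) :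
    ∃ r l : ℕ → ℕ, ∀ m, ∃ j ≥ m, ∀ N, ∃ n ≥ N, ∀ i ≤ m,
      a j (n + i) = r i ∧ a j (n - 1 - i) = l i := by
  set U : Ultrafilter ℕ := hyperfilter ℕ
  have hU : (U : Filter ℕ) ≤ atTop := by
    rw [← Nat.cofinite_eq_atTop]
    exact hyperfilter_le_cofinite
  have limit : ∀ φ : ℕ → ℕ → ℕ, (∀ i, Tendsto (φ i) atTop atTop) →
      ∃ w : ℕ → ℕ, ∀ i, ∀ᶠ j in (U : Filter ℕ), ∀ᶠ n in (U : Filter ℕ), a j (φ i n) = w i := by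
    intro φ hφ
    have h1 : ∀ j i, ∃ v ≤ A, ∀ᶠ n in (U : Filter ℕ), a j (φ i n) = v := fun j i =>
      exists_eventually_eq_of_le U (hU ((hφ i).eventually (h j)))
    choose v hvA hv using h1
    have h2 : ∀ i, ∃ w ≤ A, ∀ᶠ j in (U : Filter ℕ), v j i = w := fun i =>
      exists_eventually_eq_of_le U (Eventually.of_forall fun j => hvA j i)
    choose w _ hw using h2
    refine ⟨w, fun i => ?_⟩
    filter_upwards [hw i] with j hj
    filter_upwards [hv j i] with n hn
    rw [hn, hj]
  obtain ⟨r, hr⟩ := limit (fun i n => n + i) fun i => tendsto_add_atTop_nat i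
  obtain ⟨l, hl⟩ := limit (fun i n => n - 1 - i) fun i =>
    (tendsto_sub_atTop_nat i).comp (tendsto_sub_atTop_nat 1)
  refine ⟨r, l, fun m => ?_⟩
  have h3 : ∀ᶠ j in (U : Filter ℕ), ∀ i ∈ Finset.Iic m, ∀ᶠ n in (U : Filter ℕ),
      a j (n + i) = r i ∧ a j (n - 1 - i) = l i := by
    refine (eventually_all_finset _).2 fun i _ => ?_
    filter_upwards [hr i, hl i] with j h1 h2 using h1.and h2
  obtain ⟨j, hj, hjm⟩ := (h3.and (hU (eventually_ge_atTop m))).exists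
  refine ⟨j, hjm, fun N => ?_⟩
  obtain ⟨n, hn, hnN⟩ :=
    (((eventually_all_finset _).2 hj).and (hU (eventually_ge_atTop N))).exists
  exact ⟨n, hnN, fun i hi => hn i (Finset.mem_Iic.2 hi)⟩

lemma exists_between_of_strictMono {P : ℕ → ℕ} (hP : StrictMono P) (h0 : P 0 = 0) (n : ℕ) :
    ∃ m, P m ≤ n ∧ n < P (m + 1) := by
  induction n with
  | zero => exact ⟨0, by omega, by have := hP (Nat.lt_add_one 0); omega⟩
  | succ n ih =>
    obtain ⟨m, h1, h2⟩ := ih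
    by_cases h : n + 1 < P (m + 1)
    · exact ⟨m, by omega, h⟩
    · exact ⟨m + 1, by omega, by have := hP (Nat.lt_add_one (m + 1)); omega⟩

/-- Concatenation of blocks `b m [s m, e m)` whose ends lie at occurrences of the same two-sided
word: near every position, the resulting sequence looks like the one the block comes from. -/
lemma exists_concatenation {b : ℕ → ℕ → ℕ} {s e r l : ℕ → ℕ} (hse : ∀ m, s m + m < e m)
    (hs : ∀ m, ∀ i ≤ m, b m (s m + i) = r i ∧ b m (s m - 1 - i) = l i)
    (he : ∀ m, ∀ i ≤ m, b m (e m + i) = r i ∧ b m (e m - 1 - i) = l i) :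
    ∃ (a P : ℕ → ℕ), StrictMono P ∧ P 0 = 0 ∧ (∀ m, P (m + 1) = P m + (e m - s m)) ∧
      ∀ m i, i < e m - s m → (∀ t ≤ m, a (P m + i + t) = b m (s m + i + t)) ∧
        ∀ t < m, a (P m + i - 1 - t) = b m (s m + i - 1 - t) := by
  set P : ℕ → ℕ := fun m => ∑ j ∈ Finset.range m, (e j - s j) with hPdef
  have hP0 : P 0 = 0 := by simp [hPdef]
  have hPs : ∀ m, P (m + 1) = P m + (e m - s m) := fun m => by
    simp [hPdef, Finset.sum_range_succ]
  have hP : StrictMono P := strictMono_nat_of_lt_succ fun m => by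
    have := hse m
    rw [hPs]
    omega
  choose k hk1 hk2 using exists_between_of_strictMono hP hP0
  have hblock : ∀ m i, i < e m - s m → k (P m + i) = m := fun m i hi => by
    have h1 := hP.lt_iff_lt.1 ((hk1 (P m + i)).trans_lt (show _ < P (m + 1) by rw [hPs]; omega))
    have h2 := hP.lt_iff_lt.1 ((Nat.le_add_right (P m) i).trans_lt (hk2 (P m + i)))
    omega
  set a : ℕ → ℕ := fun n => b (k n) (s (k n) + (n - P (k n))) with hadef
  have ha : ∀ m i, i < e m - s m → a (P m + i) = b m (s m + i) := fun m i hi => by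
    simp only [hadef, hblock m i hi]
    congr 2
    omega
  refine ⟨a, P, hP, hP0, hPs, fun m i hi => ⟨fun t ht => ?_, fun t ht => ?_⟩⟩
  · by_cases hit : i + t < e m - s m
    · rw [add_assoc, ha m _ hit, add_assoc]
    · have h1 := hse m
      have h2 := hse (m + 1)
      have h3 := hPs m
      obtain ⟨d, hd⟩ : ∃ d, i + t = (e m - s m) + d := ⟨i + t - (e m - s m), by omega⟩
      rw [show P m + i + t = P (m + 1) + d by omega, ha (m + 1) d (by omega),
        show s m + i + t = e m + d by omega, (he m d (by omega)).1, (hs (m + 1) d (by omega)).1]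
  · by_cases hit : t + 1 ≤ i
    · rw [show P m + i - 1 - t = P m + (i - 1 - t) by omega, ha m _ (by omega)]
      congr 1
      omega
    · obtain ⟨m, rfl⟩ : ∃ j, m = j + 1 := ⟨m - 1, by omega⟩
      have h1 := hse m
      have h2 := hPs m
      obtain ⟨d, hd⟩ : ∃ d, t = i + d := ⟨t - i, by omega⟩
      rw [show P (m + 1) + i - 1 - t = P m + (e m - s m - 1 - d) by omega, ha m _ (by omega),
        show s m + (e m - s m - 1 - d) = e m - 1 - d by omega, (he m d (by omega)).2,
        show s (m + 1) + i - 1 - t = s (m + 1) - 1 - d by omega, (hs (m + 1) d (by omega)).2]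

lemma exists_liminf_quality_eq_zero :
    ∃ a S, IsTail a S ∧ liminf (quality a S) atTop = 0 := by
  obtain ⟨S, hS⟩ := exists_isTail (a := fun n => n + 1) fun n => by omega
  refine ⟨_, S, hS, (squeeze_zero (fun n => (hS.quality_mem_Icc n).1) (fun n => ?_)
    tendsto_one_div_add_atTop_nhds_zero_nat).liminf_eq⟩
  unfold quality
  push_cast
  exact one_div_le_one_div_of_le (by positivity)
    (by linarith [hS.nonneg (n + 1), (past_mem_Icc hS.one_le n).1])

lemma IsTail.digit_le {a : ℕ → ℕ} {S : ℕ → ℝ} (h : IsTail a S) {d : ℝ} (hd : 0 < d) {n : ℕ}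
    (hn : d < quality a S n) : a n ≤ ⌈1 / d⌉₊ := by
  have h1 := h.one_le_denom n
  rw [quality, lt_div_comm₀ hd (by positivity)] at hn
  have h2 := Nat.le_ceil (1 / d)
  have h3 : (a n : ℝ) ≤ ⌈1 / d⌉₊ := by
    linarith [h.nonneg (n + 1), (past_mem_Icc h.one_le n).1]
  exact_mod_cast h3

lemma exists_liminf_quality_eq {c : ℝ} (hc : 0 < c)
    (H : ∀ ε > 0, ∃ a S, IsTail a S ∧ |liminf (quality a S) atTop - c| < ε) :
    ∃ a S, IsTail a S ∧ liminf (quality a S) atTop = c := by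
  have H' : ∀ j : ℕ, ∃ a S, IsTail a S ∧ |liminf (quality a S) atTop - c| < c / (2 * (j + 1)) :=
    fun j => H _ (by positivity)
  choose a S hS hclose using H'
  have hhalf : ∀ j : ℕ, c / (2 * ((j : ℝ) + 1)) ≤ c / 2 := fun j =>
    div_le_div_of_nonneg_left hc.le (by positivity) (by linarith [j.cast_nonneg (α := ℝ)])
  have hmono : ∀ {m j : ℕ}, m ≤ j → c / (2 * ((j : ℝ) + 1)) ≤ c / (m + 1) := fun {m j} h => by
    have : (m : ℝ) ≤ j := by exact_mod_cast h
    exact div_le_div_of_nonneg_left hc.le (by positivity) (by linarith [j.cast_nonneg (α := ℝ)])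
  have hbdd : ∀ j, ∀ᶠ n in atTop, a j n ≤ ⌈1 / (c / 2)⌉₊ := fun j => by
    have h1 := (abs_lt.1 (hclose j)).1
    filter_upwards [(hS j).eventually_lt_of_lt_liminf (b := c / 2) (by linarith [hhalf j])]
      with n hn using (hS j).digit_le (by positivity) hn
  obtain ⟨r, l, hword⟩ := exists_limit_word hbdd
  choose J hJ hwordJ using hword
  have hpoints : ∀ m : ℕ, ∃ s t e : ℕ, m < s ∧ s ≤ t ∧ t < e ∧ s + m < e ∧
      (∀ n ≥ s, c - c / (m + 1) < quality (a (J m)) (S (J m)) n) ∧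
      quality (a (J m)) (S (J m)) t < c + c / (m + 1) ∧
      (∀ i ≤ m, a (J m) (s + i) = r i ∧ a (J m) (s - 1 - i) = l i) ∧
      (∀ i ≤ m, a (J m) (e + i) = r i ∧ a (J m) (e - 1 - i) = l i) := fun m => by
    have h1 := abs_lt.1 (hclose (J m))
    have h2 := hmono (hJ m)
    obtain ⟨N, hN⟩ := eventually_atTop.1 ((hS (J m)).eventually_lt_of_lt_liminf
      (b := c - c / (m + 1)) (by linarith))
    obtain ⟨s, hs, hsw⟩ := hwordJ m (N + m + 1)
    obtain ⟨t, ht, htq⟩ := frequently_atTop.1 ((hS (J m)).frequently_lt_of_liminf_lt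
      (b := c + c / (m + 1)) (by linarith)) s
    obtain ⟨e, he, hew⟩ := hwordJ m (t + m + 1)
    exact ⟨s, t, e, by omega, ht, by omega, by omega, fun n hn => hN n (by omega), htq, hsw, hew⟩
  choose s t e hms hst hte hse hlow hup hsw hew using hpoints
  obtain ⟨A, P, hP, hP0, hPs, hA⟩ := exists_concatenation hse hsw hew
  have hA1 : ∀ n, 1 ≤ A n := fun n => by
    obtain ⟨m, h1, h2⟩ := exists_between_of_strictMono hP hP0 n
    have h3 := (hA m (n - P m) (by rw [hPs] at h2; omega)).1 0 (by omega)
    rw [show P m + (n - P m) + 0 = n by omega] at h3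
    rw [h3]
    exact (hS (J m)).one_le _
  obtain ⟨T, hT⟩ := exists_isTail hA1
  have key : ∀ m i, i < e m - s m →
      |quality A T (P m + i) - quality (a (J m)) (S (J m)) (s m + i)| ≤ 2 / (m + 1) :=
    fun m i hi => hT.abs_quality_sub_le (hS (J m)) (le_add_right (hP.le_apply))
      (by have := hms m; omega) (hA m i hi).1 (hA m i hi).2
  have hsmall : ∀ ε > 0, ∃ M : ℕ, ∀ m ≥ M, c / ((m : ℝ) + 1) + 2 / (m + 1) < ε := fun ε hε => by
    have h1 : Tendsto (fun m : ℕ => c / ((m : ℝ) + 1) + 2 / (m + 1)) atTop (𝓝 0) := by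
      have := (tendsto_one_div_add_atTop_nhds_zero_nat (𝕜 := ℝ)).const_mul (c + 2)
      rw [mul_zero] at this
      refine this.congr fun m => ?_
      ring
    exact eventually_atTop.1 (h1.eventually_lt_const hε)
  refine ⟨A, T, hT, hT.liminf_quality_eq (fun ε hε => ?_) (fun ε hε => ?_)⟩
  · obtain ⟨M, hM⟩ := hsmall ε hε
    filter_upwards [eventually_ge_atTop (P M)] with n hn
    obtain ⟨m, h1, h2⟩ := exists_between_of_strictMono hP hP0 n
    have hMm : M ≤ m := by
      have := hP.lt_iff_lt.1 (hn.trans_lt h2)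
      omega
    have h3 := key m (n - P m) (by rw [hPs] at h2; omega)
    rw [show P m + (n - P m) = n by omega] at h3
    linarith [(abs_le.1 h3).1, hlow m (s m + (n - P m)) (by omega), hM m hMm]
  · obtain ⟨M, hM⟩ := hsmall ε hε
    refine frequently_atTop.2 fun N => ⟨P (max M N) + (t (max M N) - s (max M N)), ?_, ?_⟩
    · have := hP.le_apply (x := max M N)
      omega
    · set m := max M N
      have h1 := hst m
      have h2 := hte m
      have h3 := key m (t m - s m) (by omega)
      rw [show s m + (t m - s m) = t m by omega] at h3
      linarith [(abs_le.1 h3).2, hup m, hM m (le_max_left _ _)]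

lemma exists_irrational_iff (c : ℝ) :
    (∃ x : ℝ, Irrational x ∧
      c = liminf (fun pq : ℤ × ℤ => |(pq.2 : ℝ)| ^ 2 * |x - (pq.1 : ℝ) / (pq.2 : ℝ)|)
        (comap (fun pq : ℤ × ℤ => pq.2) atTop)) ↔
    ∃ a S, IsTail a S ∧ liminf (quality a S) atTop = c := by
  constructor
  · rintro ⟨x, hx, rfl⟩
    obtain ⟨a, S, k, hS, rfl⟩ := exists_isTail_of_irrational hx
    exact ⟨a, S, hS, (hS.liminf_eq k).symm⟩
  · rintro ⟨a, S, hS, rfl⟩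
    exact ⟨(0 : ℤ) + S 0, hS.irrational 0, (hS.liminf_eq 0).symm⟩

lemma IsTail.liminf_quality_nonneg {a : ℕ → ℕ} {S : ℕ → ℝ} (h : IsTail a S) :
    0 ≤ liminf (quality a S) atTop := by
  by_contra! hcon
  obtain ⟨n, hn⟩ := (h.frequently_lt_of_liminf_lt hcon).exists
  linarith [(h.quality_mem_Icc n).1]

end LagrangeSpectrum

open LagrangeSpectrum

/-- The classical Lagrange spectrum, consisting of the approximation constants
`c(x) = liminf_{p,q ∈ ℤ, q → +∞} |q|² |x - p/q|` of irrational numbers `x`,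
is a closed subset of `ℝ` (Cusick's theorem). -/
theorem lagrange_spectrum_isClosed :
    IsClosed { c : ℝ | ∃ x : ℝ, Irrational x ∧
      c = Filter.liminf
            (fun pq : ℤ × ℤ => |(pq.2 : ℝ)| ^ 2 * |x - (pq.1 : ℝ) / (pq.2 : ℝ)|)
            (Filter.comap (fun pq : ℤ × ℤ => pq.2) Filter.atTop) } := by
  simp only [exists_irrational_iff]
  refine isClosed_of_closure_subset fun c hc => ?_
  rw [Metric.mem_closure_iff] at hc
  have H : ∀ ε > 0, ∃ a S, IsTail a S ∧ |liminf (quality a S) atTop - c| < ε := fun ε hε => by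
    obtain ⟨_, ⟨a, S, hS, rfl⟩, hd⟩ := hc ε hε
    exact ⟨a, S, hS, by rwa [dist_comm, Real.dist_eq] at hd⟩
  have hc0 : 0 ≤ c := le_of_forall_pos_le_add fun ε hε => by
    obtain ⟨a, S, hS, hd⟩ := H ε hε
    linarith [hS.liminf_quality_nonneg, (abs_lt.1 hd).2]
  rcases hc0.eq_or_lt with rfl | hpos
  · exact exists_liminf_quality_eq_zero
  · exact exists_liminf_quality_eq hpos H
end

section
/- Let A be a quaternion algebra over ℚ ramified over ℝ (i.e. A ⊗_ℚ ℝ is a division algebra, isomorphic to Hamilton's quaternions ℍ), let O' be an order in A, and let I' be a nonzero two-sided ideal of O'. Let N denote the reduced norm on A(ℝ) = A ⊗_ℚ ℝ ≅ ℍ, and let E_{I'} = { (p,q) ∈ O' × I' : there exist r, s ∈ O' with N(qr − q p q^{-1} s) = 1 }. Then the Hamilton–Lagrange spectrum Sp_{I'} = { c_{I'}(x) : x ∈ A(ℝ) \ A(ℚ) } is a closed subset of ℝ, where c_{I'}(x) = liminf over (p,q) ∈ E_{I'} with N(q) → ∞ of N(q) · N(x − p q^{-1})^{1/2}. -/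
open Filter Topology

section Moebius

variable {D : Type*} [NormedDivisionRing D]

/-- The denominator `c z + d` of the Möbius action of a two by two matrix. -/
def moebDen (g : Matrix (Fin 2) (Fin 2) D) (z : D) : D := g 1 0 * z + g 1 1

/-- The Möbius action `(a z + b) (c z + d)⁻¹` of a two by two matrix. -/
def moeb (g : Matrix (Fin 2) (Fin 2) D) (z : D) : D := (g 0 0 * z + g 0 1) * (moebDen g z)⁻¹

/-- The image `a c⁻¹` of the point at infinity under the Möbius action. -/
def moebInf (g : Matrix (Fin 2) (Fin 2) D) : D := g 0 0 * (g 1 0)⁻¹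

/-- The normalized denominator `‖c‖ ‖c z + d‖`, which measures the approximation of `z` by the
pole of `g`. -/
def cuspDist (g : Matrix (Fin 2) (Fin 2) D) (z : D) : ℝ := ‖g 1 0‖ * ‖moebDen g z‖

theorem moebDen_mul (g h : Matrix (Fin 2) (Fin 2) D) {z : D} (hz : moebDen h z ≠ 0) :
    moebDen (g * h) z = moebDen g (moeb h z) * moebDen h z := by
  have e : moeb h z * moebDen h z = h 0 0 * z + h 0 1 := by
    rw [moeb, mul_assoc, inv_mul_cancel₀ hz, mul_one]
  have e' : moebDen g (moeb h z) * moebDen h z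
      = g 1 0 * (moeb h z * moebDen h z) + g 1 1 * moebDen h z := by
    rw [moebDen]; noncomm_ring
  rw [e', e]
  simp only [moebDen, Matrix.mul_apply, Fin.sum_univ_two]
  noncomm_ring

theorem moeb_mul (g h : Matrix (Fin 2) (Fin 2) D) {z : D} (hz : moebDen h z ≠ 0) :
    moeb (g * h) z = moeb g (moeb h z) := by
  have e : moeb h z * moebDen h z = h 0 0 * z + h 0 1 := by
    rw [moeb, mul_assoc, inv_mul_cancel₀ hz, mul_one]
  have e' : (g * h) 0 0 * z + (g * h) 0 1
      = (g 0 0 * moeb h z + g 0 1) * moebDen h z := by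
    rw [add_mul, mul_assoc, e]
    simp only [moebDen, Matrix.mul_apply, Fin.sum_univ_two]
    noncomm_ring
  rw [moeb, e', moebDen_mul g h hz, mul_inv_rev, mul_assoc, mul_inv_cancel_left₀ hz]
  rfl

theorem lowerLeft_mul (g h : Matrix (Fin 2) (Fin 2) D) (hh : h 1 0 ≠ 0) :
    (g * h) 1 0 = moebDen g (moebInf h) * h 1 0 := by
  simp only [moebDen, moebInf, Matrix.mul_apply, Fin.sum_univ_two]
  rw [add_mul, mul_assoc, mul_assoc, inv_mul_cancel₀ hh, mul_one]

theorem moebInf_mul (g h : Matrix (Fin 2) (Fin 2) D) (hh : h 1 0 ≠ 0) :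
    moebInf (g * h) = moeb g (moebInf h) := by
  have e : (g * h) 0 0 = (g 0 0 * moebInf h + g 0 1) * h 1 0 := by
    simp only [moebInf, Matrix.mul_apply, Fin.sum_univ_two]
    rw [add_mul, mul_assoc, mul_assoc, inv_mul_cancel₀ hh, mul_one]
  rw [moebInf, e, lowerLeft_mul g h hh, mul_inv_rev, mul_assoc, mul_inv_cancel_left₀ hh, moeb]

theorem norm_moebDen_sub (g : Matrix (Fin 2) (Fin 2) D) (z w : D) :
    ‖moebDen g z - moebDen g w‖ = ‖g 1 0‖ * ‖z - w‖ := by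
  rw [← norm_mul]; congr 1; simp only [moebDen]; noncomm_ring

theorem norm_moebDen_le (g : Matrix (Fin 2) (Fin 2) D) (z w : D) :
    ‖moebDen g z‖ ≤ ‖moebDen g w‖ + ‖g 1 0‖ * ‖z - w‖ := by
  rw [← norm_moebDen_sub]
  linarith [norm_sub_norm_le (moebDen g z) (moebDen g w)]

theorem cuspDist_mul (g h : Matrix (Fin 2) (Fin 2) D) {z : D} (hh : h 1 0 ≠ 0)
    (hz : moebDen h z ≠ 0) :
    cuspDist (g * h) z = ‖moebDen g (moebInf h)‖ * ‖moebDen g (moeb h z)‖ * cuspDist h z := by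
  rw [cuspDist, lowerLeft_mul g h hh, moebDen_mul g h hz, norm_mul, norm_mul, cuspDist]
  ring

variable {g : (Matrix (Fin 2) (Fin 2) D)ˣ}

theorem inv_lowerLeft_mul_moebInf (hc : g.1 1 0 ≠ 0) :
    (g⁻¹).1 1 1 = -((g⁻¹).1 1 0 * moebInf g.1) := by
  have e : ((g⁻¹).1 * g.1) 1 0 = 0 := by simp
  rw [lowerLeft_mul _ _ hc] at e
  have e2 := (mul_eq_zero.1 e).resolve_right hc
  rw [moebDen] at e2
  exact eq_neg_of_add_eq_zero_right e2

theorem inv_lowerLeft_mul_schur (hc : g.1 1 0 ≠ 0) :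
    (g⁻¹).1 1 0 * (g.1 0 1 - moebInf g.1 * g.1 1 1) = 1 := by
  have e : ((g⁻¹).1 * g.1) 1 1 = 1 := by simp
  rw [Matrix.mul_apply, Fin.sum_univ_two, inv_lowerLeft_mul_moebInf hc] at e
  rw [← e]; noncomm_ring

theorem moeb_sub_moebInf (hc : g.1 1 0 ≠ 0) {z : D} (hz : moebDen g.1 z ≠ 0) :
    moeb g.1 z - moebInf g.1 = (g.1 0 1 - moebInf g.1 * g.1 1 1) * (moebDen g.1 z)⁻¹ := by
  have e : moebInf g.1 = moebInf g.1 * moebDen g.1 z * (moebDen g.1 z)⁻¹ := by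
    rw [mul_assoc, mul_inv_cancel₀ hz, mul_one]
  have e3 : moebInf g.1 * g.1 1 0 = g.1 0 0 := by
    rw [moebInf, mul_assoc, inv_mul_cancel₀ hc, mul_one]
  have e2 : moebInf g.1 * moebDen g.1 z = g.1 0 0 * z + moebInf g.1 * g.1 1 1 := by
    rw [moebDen, mul_add, ← mul_assoc, e3]
  calc moeb g.1 z - moebInf g.1
      = moeb g.1 z - moebInf g.1 * moebDen g.1 z * (moebDen g.1 z)⁻¹ := by rw [← e]
    _ = _ := by rw [e2, moeb, ← sub_mul]; congr 1; abel

/-- The distance between the images of `z` and of infinity under a matrix of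
determinant of norm one. -/
theorem norm_moeb_sub_moebInf (hK : ‖g.1 1 0‖ = ‖(g⁻¹).1 1 0‖) (hc : g.1 1 0 ≠ 0) {z : D}
    (hz : moebDen g.1 z ≠ 0) :
    ‖moeb g.1 z - moebInf g.1‖ * cuspDist g.1 z = 1 := by
  have h1 := congrArg norm (inv_lowerLeft_mul_schur hc)
  rw [norm_mul, norm_one, ← hK] at h1
  rw [moeb_sub_moebInf hc hz, norm_mul, norm_inv, cuspDist]
  have : ‖moebDen g.1 z‖ ≠ 0 := norm_ne_zero_iff.2 hz
  field_simp
  linarith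

theorem norm_moebDen_inv (hK : ‖g.1 1 0‖ = ‖(g⁻¹).1 1 0‖) (hc : g.1 1 0 ≠ 0) (z : D) :
    ‖moebDen (g⁻¹).1 z‖ = ‖g.1 1 0‖ * ‖z - moebInf g.1‖ := by
  rw [moebDen, inv_lowerLeft_mul_moebInf hc, hK, ← norm_mul, mul_sub, sub_eq_add_neg]

theorem moebDen_one (z : D) : moebDen (1 : Matrix (Fin 2) (Fin 2) D) z = 1 := by simp [moebDen]

theorem moeb_one (z : D) : moeb (1 : Matrix (Fin 2) (Fin 2) D) z = z := by
  simp [moeb, moebDen]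

theorem moebDen_moeb_inv {z : D} (hz : moebDen (g⁻¹).1 z ≠ 0) :
    moebDen g.1 (moeb (g⁻¹).1 z) ≠ 0 := by
  have := moebDen_mul g.1 (g⁻¹).1 hz
  rw [Units.mul_inv, moebDen_one] at this
  exact left_ne_zero_of_mul (this ▸ one_ne_zero)

theorem moeb_moeb_inv {z : D} (hz : moebDen (g⁻¹).1 z ≠ 0) :
    moeb g.1 (moeb (g⁻¹).1 z) = z := by
  rw [← moeb_mul g.1 (g⁻¹).1 hz, Units.mul_inv, moeb_one]

theorem continuousAt_moeb (g : Matrix (Fin 2) (Fin 2) D) {z : D} (hz : moebDen g z ≠ 0) :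
    ContinuousAt (moeb g) z := by
  unfold moeb
  refine ContinuousAt.mul (by fun_prop) (ContinuousAt.inv₀ ?_ hz)
  unfold moebDen; fun_prop

end Moebius

section CuspGroup

variable {D : Type*} [NormedDivisionRing D]

/-- A group of two by two matrices of determinant of norm one whose lower left entries have
norm `0` or at least `1`, and in which the elements fixing infinity are isometries. -/
structure IsCuspGroup (Γ : Subgroup (Matrix (Fin 2) (Fin 2) D)ˣ) : Prop where
  norm_lowerLeft_inv : ∀ g ∈ Γ, ‖g.1 1 0‖ = ‖(g⁻¹).1 1 0‖
  one_le_norm_lowerLeft : ∀ g ∈ Γ, g.1 1 0 ≠ 0 → 1 ≤ ‖g.1 1 0‖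
  norm_lowerRight : ∀ g ∈ Γ, g.1 1 0 = 0 → ‖g.1 1 1‖ = 1

/-- The translations in `Γ` act cocompactly, with a fundamental domain in the ball of
radius `R`. -/
def HasTranslations (Γ : Subgroup (Matrix (Fin 2) (Fin 2) D)ˣ) (R : ℝ) : Prop :=
  ∀ z : D, ∃ t ∈ Γ, ∃ τ : D, t.1 = !![1, τ; 0, 1] ∧ ‖z + τ‖ ≤ R

/-- Up to an error `ε`, the lower limit of `cuspDist h x` over `h ∈ Γ` equals `c`. -/
def IsAlmostCuspLiminf (Γ : Subgroup (Matrix (Fin 2) (Fin 2) D)ˣ) (c ε : ℝ) (x : D) : Prop :=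
  (∃ T : ℝ, ∀ h ∈ Γ, T ≤ ‖h.1 1 0‖ → c - ε ≤ cuspDist h.1 x) ∧
    ∀ T : ℝ, ∃ h ∈ Γ, T ≤ ‖h.1 1 0‖ ∧ cuspDist h.1 x ≤ c + ε

/-- The pair `(ξ, η)` is a limit of images of `(∞, x)` by elements of `Γ` with large
denominators, up to an error `ε`. -/
def IsAlmostLimitPair (Γ : Subgroup (Matrix (Fin 2) (Fin 2) D)ˣ) (ε : ℝ) (x ξ η : D) : Prop :=
  ∀ T : ℝ, ∃ h ∈ Γ, T ≤ ‖h.1 1 0‖ ∧ ‖moebInf h.1 - ξ‖ ≤ ε ∧ ‖moeb h.1 x - η‖ ≤ ε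

variable {Γ : Subgroup (Matrix (Fin 2) (Fin 2) D)ˣ} {c : ℝ}

theorem ne_zero_of_cuspDist_pos {h : (Matrix (Fin 2) (Fin 2) D)ˣ} {x : D}
    (hpos : 0 < cuspDist h.1 x) : h.1 1 0 ≠ 0 ∧ moebDen h.1 x ≠ 0 := by
  constructor <;> intro h0 <;> simp [cuspDist, h0] at hpos

theorem exists_almostLimitPair [ProperSpace D] (hΓ : IsCuspGroup Γ) {R : ℝ}
    (hR : HasTranslations Γ R) (hc : 0 < c) {ε : ℝ} (hε : ε ≤ c / 2) {x : D}
    (hx : IsAlmostCuspLiminf Γ c ε x) :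
    ∃ p ∈ Metric.closedBall (0 : D) R ×ˢ Metric.closedBall (0 : D) (R + 2 / c),
      (c + ε)⁻¹ ≤ ‖p.2 - p.1‖ ∧ ‖p.2 - p.1‖ ≤ (c - ε)⁻¹ ∧
      ∀ ε' > 0, IsAlmostLimitPair Γ ε' x p.1 p.2 := by
  obtain ⟨⟨T, hT⟩, hfr⟩ := hx
  have key : ∀ n : ℕ, ∃ h ∈ Γ, (n : ℝ) ≤ ‖h.1 1 0‖ ∧ ‖moebInf h.1‖ ≤ R ∧
      (c + ε)⁻¹ ≤ ‖moeb h.1 x - moebInf h.1‖ ∧ ‖moeb h.1 x - moebInf h.1‖ ≤ (c - ε)⁻¹ := by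
    intro n
    obtain ⟨h, hh, hn, hle⟩ := hfr (max n T)
    have hge := hT h hh ((le_max_right _ _).trans hn)
    have hpos : 0 < cuspDist h.1 x := by linarith
    obtain ⟨h0, hd⟩ := ne_zero_of_cuspDist_pos hpos
    obtain ⟨t, ht, τ, hτ, hb⟩ := hR (moebInf h.1)
    have e1 : (t * h).1 1 0 = h.1 1 0 := by
      simp [Matrix.mul_apply, Fin.sum_univ_two, hτ]
    have e2 : moebInf (t * h).1 = moebInf h.1 + τ := by
      rw [Units.val_mul, moebInf_mul _ _ h0, hτ]; simp [moeb, moebDen]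
    have e3 : moeb (t * h).1 x = moeb h.1 x + τ := by
      rw [Units.val_mul, moeb_mul _ _ hd, hτ]; simp [moeb, moebDen]
    have e4 := norm_moeb_sub_moebInf (hΓ.norm_lowerLeft_inv h hh) h0 hd
    have e5 : ‖moeb h.1 x - moebInf h.1‖ = (cuspDist h.1 x)⁻¹ := eq_inv_of_mul_eq_one_left e4
    refine ⟨t * h, Γ.mul_mem ht hh, ?_, ?_, ?_⟩
    · rw [e1]; exact (le_max_left _ _).trans hn
    · rwa [e2]
    · rw [e2, e3, add_sub_add_right_eq_sub, e5]
      exact ⟨inv_anti₀ hpos hle, inv_anti₀ (by linarith) hge⟩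
  choose h hΓh hn hb hl hu using key
  have hK : IsCompact (Metric.closedBall (0 : D) R ×ˢ Metric.closedBall (0 : D) (R + 2 / c)) :=
    (isCompact_closedBall _ _).prod (isCompact_closedBall _ _)
  have hmem : ∀ n, (moebInf (h n).1, moeb (h n).1 x) ∈
      Metric.closedBall (0 : D) R ×ˢ Metric.closedBall (0 : D) (R + 2 / c) := by
    intro n
    refine ⟨by simpa using hb n, ?_⟩
    have h1 := hu n
    have h2 : (c - ε)⁻¹ ≤ 2 / c := by
      rw [show 2 / c = (c / 2)⁻¹ by field_simp]
      exact inv_anti₀ (by linarith) (by linarith)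
    have h3 := norm_le_norm_add_norm_sub' (moeb (h n).1 x) (moebInf (h n).1)
    simp only [Metric.mem_closedBall, dist_zero_right]
    linarith [hb n]
  obtain ⟨p, hp, φ, hφ, hlim⟩ := hK.tendsto_subseq hmem
  have hl1 : Tendsto (fun n => moebInf (h (φ n)).1) atTop (𝓝 p.1) :=
    (continuous_fst.tendsto p).comp hlim
  have hl2 : Tendsto (fun n => moeb (h (φ n)).1 x) atTop (𝓝 p.2) :=
    (continuous_snd.tendsto p).comp hlim
  have hl3 := (hl2.sub hl1).norm
  refine ⟨p, hp, ge_of_tendsto' hl3 fun n => hl _, le_of_tendsto' hl3 fun n => hu _, ?_⟩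
  intro ε' hε' T'
  have a1 := (Metric.tendsto_nhds.1 hl1) ε' hε'
  have a2 := (Metric.tendsto_nhds.1 hl2) ε' hε'
  have a3 : ∀ᶠ n in atTop, T' ≤ (φ n : ℝ) :=
    (tendsto_natCast_atTop_atTop.comp hφ.tendsto_atTop).eventually_ge_atTop T'
  obtain ⟨n, b1, b2, b3⟩ := (a1.and (a2.and a3)).exists
  exact ⟨h (φ n), hΓh _, b3.trans (hn _), by rw [← dist_eq_norm]; exact b1.le,
    by rw [← dist_eq_norm]; exact b2.le⟩

theorem exists_common_limitPair [ProperSpace D] (hΓ : IsCuspGroup Γ) {R : ℝ}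
    (hR : HasTranslations Γ R) (hc : 0 < c) (H : ∀ ε > 0, ∃ x, IsAlmostCuspLiminf Γ c ε x) :
    ∃ ξ η : D, ‖η - ξ‖ = c⁻¹ ∧ ∀ ε > 0, ∃ x, IsAlmostCuspLiminf Γ c ε x ∧
      IsAlmostLimitPair Γ ε x ξ η := by
  have hεpos : ∀ j : ℕ, 0 < c / 2 * (1 / ((j : ℝ) + 1)) := fun j => by positivity
  have hεle : ∀ j : ℕ, c / 2 * (1 / ((j : ℝ) + 1)) ≤ c / 2 := fun j => by
    have : 1 / ((j : ℝ) + 1) ≤ 1 := by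
      rw [div_le_one (by positivity)]; linarith [(Nat.cast_nonneg j : (0 : ℝ) ≤ j)]
    nlinarith
  choose x hx using fun j : ℕ => H _ (hεpos j)
  choose p hp hl hu hlim using fun j : ℕ => exists_almostLimitPair hΓ hR hc (hεle j) (hx j)
  obtain ⟨q, -, φ, hφ, hq⟩ := ((isCompact_closedBall (0 : D) R).prod
    (isCompact_closedBall (0 : D) (R + 2 / c))).tendsto_subseq hp
  have hl1 : Tendsto (fun n => (p (φ n)).1) atTop (𝓝 q.1) := (continuous_fst.tendsto q).comp hq
  have hl2 : Tendsto (fun n => (p (φ n)).2) atTop (𝓝 q.2) := (continuous_snd.tendsto q).comp hq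
  have hε0 : Tendsto (fun n => c / 2 * (1 / ((φ n : ℝ) + 1))) atTop (𝓝 0) := by
    have := (tendsto_one_div_add_atTop_nhds_zero_nat (𝕜 := ℝ)).comp hφ.tendsto_atTop
    simpa using this.const_mul (c / 2)
  refine ⟨q.1, q.2, ?_, ?_⟩
  · have hl3 := (hl2.sub hl1).norm
    refine le_antisymm ?_ ?_
    · refine le_of_tendsto_of_tendsto' hl3 (b := atTop) ?_ fun n => hu (φ n)
      have := (tendsto_const_nhds.sub hε0 : Tendsto _ _ (𝓝 (c - 0))).inv₀ (by simpa using hc.ne')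
      simpa using this
    · refine le_of_tendsto_of_tendsto' (b := atTop) ?_ hl3 fun n => hl (φ n)
      have := (tendsto_const_nhds.add hε0 : Tendsto _ _ (𝓝 (c + 0))).inv₀ (by simpa using hc.ne')
      simpa using this
  · intro ε hε
    have a1 := (Metric.tendsto_nhds.1 hl1) (ε / 2) (by positivity)
    have a2 := (Metric.tendsto_nhds.1 hl2) (ε / 2) (by positivity)
    have a3 := hε0.eventually_lt_const hε
    obtain ⟨n, b1, b2, b3⟩ := (a1.and (a2.and a3)).exists
    rw [dist_eq_norm] at b1 b2
    refine ⟨x (φ n), ⟨?_, ?_⟩, ?_⟩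
    · obtain ⟨T, hT⟩ := (hx (φ n)).1
      exact ⟨T, fun h hh hTh => le_trans (by linarith) (hT h hh hTh)⟩
    · intro T
      obtain ⟨h, hh, hTh, hle⟩ := (hx (φ n)).2 T
      exact ⟨h, hh, hTh, by linarith⟩
    · intro T
      obtain ⟨h, hh, hTh, h1, h2⟩ := hlim (φ n) (ε / 2) (by positivity) T
      refine ⟨h, hh, hTh, ?_, ?_⟩
      · linarith [norm_sub_le_norm_sub_add_norm_sub (moebInf h.1) (p (φ n)).1 q.1]
      · linarith [norm_sub_le_norm_sub_add_norm_sub (moeb h.1 (x (φ n))) (p (φ n)).2 q.2]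

/-- An element `γ` of `Γ` which brings a neighbourhood of the pair `(ξ, η)` back to itself,
strongly expanding at `η`, together with a pair `(w, y)` close to `(ξ, η)` controlling the
elements of `Γ` met in between. -/
structure IsReturn (Γ : Subgroup (Matrix (Fin 2) (Fin 2) D)ˣ) (c t : ℝ) (ξ η w y : D)
    (γ : (Matrix (Fin 2) (Fin 2) D)ˣ) : Prop where
  mem : γ ∈ Γ
  left_near : ‖w - ξ‖ ≤ t ^ 2
  right_near : ‖y - η‖ ≤ t ^ 2
  moebDen_ne_zero : moebDen γ.1 y ≠ 0
  moeb_near : ‖moeb γ.1 y - η‖ ≤ t ^ 2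
  moebInf_near : ‖moebInf γ.1 - ξ‖ ≤ t ^ 2
  pole_near : ‖moebDen γ.1 η‖ ≤ t ^ 2 * ‖γ.1 1 0‖
  large : 1 ≤ t ^ 2 * ‖γ.1 1 0‖
  lower : ∀ k ∈ Γ, t * ‖k.1 1 0‖ ≤ ‖moebDen k.1 ξ‖ →
    (c - t ^ 2) * ‖y - w‖ ≤ ‖moebDen k.1 w‖ * ‖moebDen k.1 y‖

theorem IsCuspGroup.le_norm_moebDen (hΓ : IsCuspGroup Γ) {k : (Matrix (Fin 2) (Fin 2) D)ˣ}
    (hk : k ∈ Γ) {t : ℝ} (ht : 0 ≤ t) (ht1 : t ≤ 1) {ξ : D}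
    (h : t * ‖k.1 1 0‖ ≤ ‖moebDen k.1 ξ‖) : t ≤ ‖moebDen k.1 ξ‖ := by
  by_cases h0 : k.1 1 0 = 0
  · have := hΓ.norm_lowerRight k hk h0
    rw [moebDen, h0, zero_mul, zero_add, this]
    exact ht1
  · have := hΓ.one_le_norm_lowerLeft k hk h0
    nlinarith

theorem exists_isReturn (hΓ : IsCuspGroup Γ) (hc : 0 < c) {ξ η : D} (hξη : ‖η - ξ‖ = c⁻¹)
    (H : ∀ ε > 0, ∃ x, IsAlmostCuspLiminf Γ c ε x ∧ IsAlmostLimitPair Γ ε x ξ η)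
    {t : ℝ} (ht : 0 < t) (ht1 : t ≤ 1 / 100) (htL : t ≤ c⁻¹ / 100) (htc : t ≤ c / 2) :
    ∃ w y γ, IsReturn Γ c t ξ η w y γ := by
  set L := c⁻¹ with hL
  have hLpos : 0 < L := inv_pos.2 hc
  have hcL : c * L = 1 := mul_inv_cancel₀ hc.ne'
  have ht2 : 0 < t ^ 2 := by positivity
  have ht2t : t ^ 2 ≤ t / 100 := by nlinarith
  obtain ⟨x, ⟨⟨T, hT⟩, -⟩, hlim⟩ := H (t ^ 2 / 2) (by positivity)
  obtain ⟨h, hh, hTh, hw, hy⟩ := hlim (max T (2 * T / t))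
  set Q : ℝ := 4 + 4 * L / t ^ 2 with hQ
  have hQt : Q * t ^ 2 = 4 * t ^ 2 + 4 * L := by rw [hQ]; field_simp
  have hQ4 : 4 ≤ Q := by rw [hQ]; have : 0 < 4 * L / t ^ 2 := by positivity
                         linarith
  obtain ⟨h', hh', hTh', hw', hy'⟩ := hlim (max T (Q * ‖h.1 1 0‖))
  have hF := hT h hh ((le_max_left _ _).trans hTh)
  have hF' := hT h' hh' ((le_max_left _ _).trans hTh')
  have hTC : T ≤ t / 2 * ‖h.1 1 0‖ := by
    have := (le_max_right _ _).trans hTh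
    rw [div_le_iff₀ ht] at this
    linarith
  have hCC' : Q * ‖h.1 1 0‖ ≤ ‖h'.1 1 0‖ := (le_max_right _ _).trans hTh'
  obtain ⟨h0, hd⟩ := ne_zero_of_cuspDist_pos (h := h) (x := x) (by linarith)
  obtain ⟨h0', hd'⟩ := ne_zero_of_cuspDist_pos (h := h') (x := x) (by linarith)
  have hC := norm_pos_iff.2 h0
  have hC' := norm_pos_iff.2 h0'
  have hδ := norm_pos_iff.2 hd
  have hE := norm_moeb_sub_moebInf (hΓ.norm_lowerLeft_inv h hh) h0 hd
  have hE' := norm_moeb_sub_moebInf (hΓ.norm_lowerLeft_inv h' hh') h0' hd'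
  obtain ⟨γ, hγ⟩ : ∃ γ, γ = h' * h⁻¹ := ⟨_, rfl⟩
  have hγmem : γ ∈ Γ := hγ ▸ Γ.mul_mem hh' (Γ.inv_mem hh)
  have hγh : h'.1 = γ.1 * h.1 := by rw [← Units.val_mul, hγ, inv_mul_cancel_right]
  set w := moebInf h.1 with hwdef
  set y := moeb h.1 x with hydef
  have e1 : ‖h'.1 1 0‖ = ‖moebDen γ.1 w‖ * ‖h.1 1 0‖ := by
    rw [hγh, lowerLeft_mul _ _ h0, norm_mul]
  have e2 : moebDen h'.1 x = moebDen γ.1 y * moebDen h.1 x := by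
    rw [hγh, moebDen_mul _ _ hd]
  have e3 : moeb h'.1 x = moeb γ.1 y := by rw [hγh, moeb_mul _ _ hd]
  have e4 : moebInf h'.1 = moeb γ.1 w := by rw [hγh, moebInf_mul _ _ h0]
  have hdy : moebDen γ.1 y ≠ 0 := left_ne_zero_of_mul (e2 ▸ hd')
  have hQw : Q ≤ ‖moebDen γ.1 w‖ := by
    rw [e1] at hCC'
    exact le_of_mul_le_mul_right hCC' hC
  have hdw : moebDen γ.1 w ≠ 0 := norm_pos_iff.1 (by linarith)
  have dist_le : ∀ {u v : D}, ‖u - ξ‖ ≤ t ^ 2 / 2 → ‖v - η‖ ≤ t ^ 2 / 2 →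
      L / 2 ≤ ‖v - u‖ ∧ ‖v - u‖ ≤ 2 * L := by
    intro u v hu hv
    have a1 : ‖v - u‖ ≤ ‖v - η‖ + ‖η - ξ‖ + ‖u - ξ‖ := by
      have : v - u = (v - η) + (η - ξ) - (u - ξ) := by abel
      rw [this]; exact (norm_sub_le _ _).trans (add_le_add_left (norm_add_le _ _) _)
    have a2 : ‖η - ξ‖ ≤ ‖v - u‖ + ‖v - η‖ + ‖u - ξ‖ := by
      have : η - ξ = (v - u) - (v - η) + (u - ξ) := by abel
      rw [this]; exact (norm_add_le _ _).trans (add_le_add_left (norm_sub_le _ _) _)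
    constructor <;> linarith
  have hywle := (dist_le hw hy).2
  have hFub' : cuspDist h'.1 x ≤ 2 * c := by
    have a1 := (dist_le hw' hy').1
    have a2 : 0 < cuspDist h'.1 x := by linarith
    have a3 := mul_le_mul_of_nonneg_right a1 a2.le
    rw [hE'] at a3
    calc cuspDist h'.1 x = (c * L) * cuspDist h'.1 x := by rw [hcL, one_mul]
      _ = 2 * c * (L / 2 * cuspDist h'.1 x) := by ring
      _ ≤ 2 * c * 1 := by gcongr
      _ = 2 * c := mul_one _
  have hdy1 : ‖moebDen γ.1 y‖ ≤ 1 := by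
    have a1 : ‖h'.1 1 0‖ * (‖moebDen γ.1 y‖ * ‖moebDen h.1 x‖) ≤ 2 * c := by
      rw [← norm_mul, ← e2]; exact hFub'
    have a2 : c / 2 ≤ ‖h.1 1 0‖ * ‖moebDen h.1 x‖ := by
      have : cuspDist h.1 x = ‖h.1 1 0‖ * ‖moebDen h.1 x‖ := rfl
      linarith
    have a3 : 4 * ‖h.1 1 0‖ ≤ ‖h'.1 1 0‖ :=
      (mul_le_mul_of_nonneg_right hQ4 hC.le).trans hCC'
    by_contra hcon
    push Not at hcon
    have a4 : 4 * ‖h.1 1 0‖ * ‖moebDen h.1 x‖ ≤ ‖h'.1 1 0‖ * ‖moebDen h.1 x‖ :=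
      mul_le_mul_of_nonneg_right a3 hδ.le
    have a5 : ‖h'.1 1 0‖ * ‖moebDen h.1 x‖ * 1 <
        ‖h'.1 1 0‖ * ‖moebDen h.1 x‖ * ‖moebDen γ.1 y‖ :=
      mul_lt_mul_of_pos_left hcon (by positivity)
    linarith
  have hcγ : 2 ≤ t ^ 2 * ‖γ.1 1 0‖ := by
    have a1 := norm_moebDen_le γ.1 w y
    rw [norm_sub_rev] at a1
    have a2 : ‖γ.1 1 0‖ * ‖y - w‖ ≤ ‖γ.1 1 0‖ * (2 * L) :=
      mul_le_mul_of_nonneg_left hywle (norm_nonneg _)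
    have a3 : Q ≤ 1 + ‖γ.1 1 0‖ * (2 * L) := by linarith
    have a4 := mul_le_mul_of_nonneg_right a3 ht2.le
    rw [hQt] at a4
    refine le_of_mul_le_mul_right ?_ (show 0 < 2 * L by positivity)
    linarith
  have hγ0 : γ.1 1 0 ≠ 0 := by
    intro h0; rw [h0, norm_zero] at hcγ; linarith
  refine ⟨w, y, γ, hγmem, by linarith, by linarith, hdy, by rw [← e3]; linarith, ?_, ?_,
    by linarith, ?_⟩
  · have a1 := norm_moeb_sub_moebInf (hΓ.norm_lowerLeft_inv γ hγmem) hγ0 hdw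
    rw [← e4, cuspDist, norm_sub_rev] at a1
    have a2 := norm_sub_le_norm_sub_add_norm_sub (moebInf γ.1) (moebInf h'.1) ξ
    have a3 : ‖γ.1 1 0‖ * 4 ≤ ‖γ.1 1 0‖ * ‖moebDen γ.1 w‖ :=
      mul_le_mul_of_nonneg_left (hQ4.trans hQw) (norm_nonneg _)
    have a5 : ‖moebInf γ.1 - moebInf h'.1‖ ≤ t ^ 2 / 2 := by
      by_contra hcon
      push Not at hcon
      have a4 := mul_le_mul hcon.le a3 (by positivity) (norm_nonneg _)
      linarith
    linarith
  · have a1 := norm_moebDen_le γ.1 η y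
    rw [norm_sub_rev] at a1
    have a2 : ‖γ.1 1 0‖ * ‖y - η‖ ≤ ‖γ.1 1 0‖ * (t ^ 2 / 2) :=
      mul_le_mul_of_nonneg_left hy (norm_nonneg _)
    linarith
  · intro k hk hkξ
    have a1 := hΓ.le_norm_moebDen hk ht.le (by linarith) hkξ
    have a2 := norm_moebDen_le k.1 ξ w
    rw [norm_sub_rev] at a2
    have a3 : ‖k.1 1 0‖ * ‖w - ξ‖ ≤ ‖k.1 1 0‖ * (t / 2) :=
      mul_le_mul_of_nonneg_left (by linarith) (norm_nonneg _)
    have a4 : t / 2 ≤ ‖moebDen k.1 w‖ := by linarith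
    have a5 : T ≤ ‖(k * h).1 1 0‖ := by
      rw [Units.val_mul, lowerLeft_mul _ _ h0, norm_mul]
      exact hTC.trans (mul_le_mul_of_nonneg_right a4 hC.le)
    have a6 := hT (k * h) (Γ.mul_mem hk hh) a5
    rw [Units.val_mul, cuspDist_mul _ _ h0 hd] at a6
    have a7 := mul_le_mul_of_nonneg_right a6 (norm_nonneg (y - w))
    rw [mul_assoc, mul_comm (cuspDist _ _), hE, mul_one] at a7
    refine le_trans (mul_le_mul_of_nonneg_right ?_ (norm_nonneg _)) a7
    linarith

section Return

variable {t : ℝ} {ξ η w y : D} {γ : (Matrix (Fin 2) (Fin 2) D)ˣ}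

theorem IsReturn.norm_pos (hr : IsReturn Γ c t ξ η w y γ) : 0 < ‖γ.1 1 0‖ := by
  have := hr.large
  by_contra hcon
  have h0 : ‖γ.1 1 0‖ = 0 := le_antisymm (not_lt.1 hcon) (norm_nonneg _)
  rw [h0] at this
  linarith

theorem IsReturn.two_mul_le_norm (hr : IsReturn Γ c t ξ η w y γ) (hc : 0 < c) (ht : 0 < t)
    (ht1 : t ≤ 1 / 100) (htL : t ≤ c⁻¹ / 100) : 2 * c ≤ t ^ 2 * ‖γ.1 1 0‖ * ‖γ.1 1 0‖ := by
  have hcL : c * c⁻¹ = 1 := mul_inv_cancel₀ hc.ne'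
  have h1 : t * c ≤ 1 / 100 := by
    calc t * c ≤ c⁻¹ / 100 * c := by gcongr
      _ = 1 / 100 := by linarith
  have h2 : t ^ 2 * (2 * c) ≤ t ^ 2 * ‖γ.1 1 0‖ := by nlinarith [hr.large]
  have h3 : 2 * c ≤ ‖γ.1 1 0‖ := le_of_mul_le_mul_left h2 (by positivity)
  nlinarith [hr.large, hr.norm_pos]

theorem IsReturn.contract (hΓ : IsCuspGroup Γ) (hr : IsReturn Γ c t ξ η w y γ) (hc : 0 < c)
    (hξη : ‖η - ξ‖ = c⁻¹) (ht : 0 < t) (ht1 : t ≤ 1 / 100) (htL : t ≤ c⁻¹ / 100) {z : D}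
    (hz : moebDen γ.1 z ≠ 0) (hzη : ‖moeb γ.1 z - η‖ ≤ c⁻¹ / 8) :
    ‖moebDen γ.1 z‖ * ‖γ.1 1 0‖ ≤ 2 * c ∧ ‖z - η‖ ≤ 2 * t ^ 2 := by
  have hcL : c * c⁻¹ = 1 := mul_inv_cancel₀ hc.ne'
  have hLpos : 0 < c⁻¹ := inv_pos.2 hc
  have hγ := hr.norm_pos
  have h1 := norm_moeb_sub_moebInf (hΓ.norm_lowerLeft_inv γ hr.mem) (norm_pos_iff.1 hγ) hz
  have h2 : c⁻¹ / 2 ≤ ‖moeb γ.1 z - moebInf γ.1‖ := by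
    have a1 : ‖η - ξ‖ ≤ ‖moeb γ.1 z - moebInf γ.1‖ + ‖moeb γ.1 z - η‖ + ‖moebInf γ.1 - ξ‖ := by
      have : η - ξ = (moeb γ.1 z - moebInf γ.1) - (moeb γ.1 z - η) + (moebInf γ.1 - ξ) := by abel
      rw [this]; exact (norm_add_le _ _).trans (add_le_add_left (norm_sub_le _ _) _)
    have := hr.moebInf_near
    nlinarith
  have h3 : ‖moebDen γ.1 z‖ * ‖γ.1 1 0‖ ≤ 2 * c := by
    have a1 : 0 ≤ ‖γ.1 1 0‖ * ‖moebDen γ.1 z‖ := by positivity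
    have a2 := mul_le_mul_of_nonneg_right h2 a1
    rw [cuspDist] at h1
    rw [h1] at a2
    calc ‖moebDen γ.1 z‖ * ‖γ.1 1 0‖
        = (c * c⁻¹) * (‖γ.1 1 0‖ * ‖moebDen γ.1 z‖) := by rw [hcL]; ring
      _ = 2 * c * (c⁻¹ / 2 * (‖γ.1 1 0‖ * ‖moebDen γ.1 z‖)) := by ring
      _ ≤ 2 * c * 1 := by gcongr
      _ = 2 * c := mul_one _
  refine ⟨h3, ?_⟩
  have h4 := norm_moebDen_sub γ.1 z η
  have h5 := norm_sub_le (moebDen γ.1 z) (moebDen γ.1 η)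
  have h6 := hr.pole_near
  have h7 := hr.two_mul_le_norm hc ht ht1 htL
  have h8 : ‖moebDen γ.1 z‖ ≤ t ^ 2 * ‖γ.1 1 0‖ :=
    le_of_mul_le_mul_right (h3.trans h7) hγ
  refine le_of_mul_le_mul_left ?_ hγ
  linarith

theorem IsReturn.preimage (hΓ : IsCuspGroup Γ) (hr : IsReturn Γ c t ξ η w y γ) (hc : 0 < c)
    (hξη : ‖η - ξ‖ = c⁻¹) (ht : 0 < t) (ht1 : t ≤ 1 / 100) (htL : t ≤ c⁻¹ / 100) {z : D}
    (hzη : ‖z - η‖ ≤ c⁻¹ / 8) :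
    moebDen (γ⁻¹).1 z ≠ 0 ∧ ‖moeb (γ⁻¹).1 z - η‖ ≤ c⁻¹ / 8 := by
  have hLpos : 0 < c⁻¹ := inv_pos.2 hc
  have hγ := hr.norm_pos
  have h1 : moebDen (γ⁻¹).1 z ≠ 0 := by
    rw [← norm_pos_iff, norm_moebDen_inv (hΓ.norm_lowerLeft_inv γ hr.mem) (norm_pos_iff.1 hγ)]
    refine mul_pos hγ ?_
    have a1 : ‖η - ξ‖ ≤ ‖z - moebInf γ.1‖ + ‖z - η‖ + ‖moebInf γ.1 - ξ‖ := by
      have : η - ξ = (z - moebInf γ.1) - (z - η) + (moebInf γ.1 - ξ) := by abel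
      rw [this]; exact (norm_add_le _ _).trans (add_le_add_left (norm_sub_le _ _) _)
    have := hr.moebInf_near
    nlinarith
  refine ⟨h1, ?_⟩
  have h2 := (hr.contract hΓ hc hξη ht ht1 htL (moebDen_moeb_inv h1)
    (by rwa [moeb_moeb_inv h1])).2
  nlinarith

theorem IsReturn.forward (hΓ : IsCuspGroup Γ) (hr : IsReturn Γ c t ξ η w y γ) (hc : 0 < c)
    (hξη : ‖η - ξ‖ = c⁻¹) (ht : 0 < t) (ht1 : t ≤ 1 / 100) (htL : t ≤ c⁻¹ / 100) {u : D}
    (hu : ‖u - ξ‖ ≤ c⁻¹ / 8) :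
    c⁻¹ / 2 * ‖γ.1 1 0‖ ≤ ‖moebDen γ.1 u‖ ∧ ‖moeb γ.1 u - ξ‖ ≤ 2 * t ^ 2 := by
  have hcL : c * c⁻¹ = 1 := mul_inv_cancel₀ hc.ne'
  have hLpos : 0 < c⁻¹ := inv_pos.2 hc
  have hγ := hr.norm_pos
  have h1 : c⁻¹ / 2 * ‖γ.1 1 0‖ ≤ ‖moebDen γ.1 u‖ := by
    have a1 := norm_moebDen_sub γ.1 η u
    have a2 := norm_sub_le (moebDen γ.1 η) (moebDen γ.1 u)
    have a3 : ‖η - ξ‖ ≤ ‖η - u‖ + ‖u - ξ‖ := norm_sub_le_norm_sub_add_norm_sub _ _ _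
    have a4 : c⁻¹ * 3 / 4 ≤ ‖η - u‖ := by linarith
    have a5 := mul_le_mul_of_nonneg_left a4 hγ.le
    have a6 : t ^ 2 ≤ c⁻¹ / 4 := by nlinarith
    have a7 := mul_le_mul_of_nonneg_right a6 hγ.le
    have := hr.pole_near
    linarith
  refine ⟨h1, ?_⟩
  have hdu : moebDen γ.1 u ≠ 0 := norm_pos_iff.1 (lt_of_lt_of_le (by positivity) h1)
  have h2 := norm_moeb_sub_moebInf (hΓ.norm_lowerLeft_inv γ hr.mem) (norm_pos_iff.1 hγ) hdu
  have h3 : ‖moeb γ.1 u - moebInf γ.1‖ ≤ t ^ 2 := by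
    have a1 := hr.two_mul_le_norm hc ht ht1 htL
    have a2 : 1 ≤ t ^ 2 * (‖γ.1 1 0‖ * ‖moebDen γ.1 u‖) := by
      calc (1 : ℝ) = 2 * c * (c⁻¹ / 2) := by linarith
        _ ≤ t ^ 2 * ‖γ.1 1 0‖ * ‖γ.1 1 0‖ * (c⁻¹ / 2) := by gcongr
        _ = t ^ 2 * (‖γ.1 1 0‖ * (c⁻¹ / 2 * ‖γ.1 1 0‖)) := by ring
        _ ≤ _ := by gcongr
    rw [← h2] at a2
    exact le_of_mul_le_mul_right a2 (by rw [cuspDist]; positivity)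
  have h4 := norm_sub_le_norm_sub_add_norm_sub (moeb γ.1 u) (moebInf γ.1) ξ
  linarith [hr.moebInf_near]

/-- The comparison of denominators along a return, for an element `k` whose pole is met between
the beginning and the end of the return. -/
theorem IsReturn.compare (hΓ : IsCuspGroup Γ) (hr : IsReturn Γ c t ξ η w y γ) (hc : 0 < c)
    (hξη : ‖η - ξ‖ = c⁻¹) (ht : 0 < t) (ht1 : t ≤ 1 / 100) (htL : t ≤ c⁻¹ / 100)
    (htc : (18 + 16 * c) * t ≤ 1) {W Y : D} (hW : ‖W - ξ‖ ≤ 8 * t ^ 2)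
    (hY : moebDen γ.1 Y ≠ 0) (hYη : ‖moeb γ.1 Y - η‖ ≤ c⁻¹ / 8)
    {k : (Matrix (Fin 2) (Fin 2) D)ˣ} (hk : k ∈ Γ) (hkξ : t * ‖k.1 1 0‖ ≤ ‖moebDen k.1 ξ‖)
    (hkγ : ‖moebDen (k * γ⁻¹).1 ξ‖ < t / 2 * ‖(k * γ⁻¹).1 1 0‖) :
    (1 - (18 + 16 * c) * t) ^ 2 * ((c - t ^ 2) * ‖y - w‖) ≤
      ‖moebDen k.1 W‖ * ‖moebDen k.1 Y‖ := by
  have hcL : c * c⁻¹ = 1 := mul_inv_cancel₀ hc.ne'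
  have hLpos : 0 < c⁻¹ := inv_pos.2 hc
  have ht2 : t ^ 2 ≤ t / 100 := by nlinarith
  have hγ := hr.norm_pos
  have hγ0 := norm_pos_iff.1 hγ
  have hleft : (1 - (18 + 16 * c) * t) * ‖moebDen k.1 w‖ ≤ ‖moebDen k.1 W‖ := by
    have a1 := norm_moebDen_le k.1 w W
    have a2 := norm_moebDen_le k.1 ξ w
    rw [norm_sub_rev] at a2
    have a3 : ‖w - W‖ ≤ 9 * t ^ 2 := by
      have := norm_sub_le_norm_sub_add_norm_sub w ξ W
      rw [norm_sub_rev ξ W] at this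
      linarith [hr.left_near]
    have a4 := mul_le_mul_of_nonneg_left a3 (norm_nonneg (k.1 1 0))
    have a5 := mul_le_mul_of_nonneg_left (hr.left_near.trans ht2) (norm_nonneg (k.1 1 0))
    have a6 : t * ‖k.1 1 0‖ ≤ 2 * ‖moebDen k.1 w‖ := by
      have := mul_nonneg ht.le (norm_nonneg (k.1 1 0))
      linarith
    have a7 := mul_le_mul_of_nonneg_left a6 ht.le
    have a8 : 0 ≤ c * t * ‖moebDen k.1 w‖ := by positivity
    linarith
  have hright : (1 - (18 + 16 * c) * t) * ‖moebDen k.1 y‖ ≤ ‖moebDen k.1 Y‖ := by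
    obtain ⟨κ, hκ⟩ : ∃ κ, κ = k * γ⁻¹ := ⟨_, rfl⟩
    rw [← hκ] at hkγ
    have hkκ : k.1 = κ.1 * γ.1 := by rw [← Units.val_mul, hκ, inv_mul_cancel_right]
    have hκn := norm_nonneg (κ.1 1 0)
    have b1 : ‖k.1 1 0‖ ≤ t * ‖κ.1 1 0‖ * ‖γ.1 1 0‖ := by
      rw [hkκ, lowerLeft_mul _ _ hγ0, norm_mul]
      refine mul_le_mul_of_nonneg_right ?_ hγ.le
      have a1 := norm_moebDen_le κ.1 (moebInf γ.1) ξ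
      have a2 := mul_le_mul_of_nonneg_left (hr.moebInf_near.trans ht2) hκn
      have a3 := mul_nonneg ht.le hκn
      linarith
    have hyη : ‖moeb γ.1 y - η‖ ≤ c⁻¹ / 8 := by linarith [hr.moeb_near]
    have c1 := (hr.contract hΓ hc hξη ht ht1 htL hY hYη).1
    have c2 := (hr.contract hΓ hc hξη ht ht1 htL hr.moebDen_ne_zero hyη).1
    have b2 : ‖γ.1 1 0‖ * ‖y - Y‖ * ‖γ.1 1 0‖ ≤ 4 * c := by
      have a1 := norm_sub_le (moebDen γ.1 y) (moebDen γ.1 Y)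
      rw [norm_moebDen_sub] at a1
      have a2 := mul_le_mul_of_nonneg_right a1 hγ.le
      linarith
    have b3 : ‖κ.1 1 0‖ ≤ 4 * (‖moebDen k.1 y‖ * ‖γ.1 1 0‖) := by
      rw [hkκ, moebDen_mul _ _ hr.moebDen_ne_zero, norm_mul]
      have a1 : c⁻¹ / 2 * ‖κ.1 1 0‖ ≤ ‖moebDen κ.1 (moeb γ.1 y)‖ := by
        have d1 := norm_sub_le (moebDen κ.1 (moeb γ.1 y)) (moebDen κ.1 ξ)
        rw [norm_moebDen_sub] at d1
        have d2 : ‖η - ξ‖ ≤ ‖moeb γ.1 y - ξ‖ + ‖moeb γ.1 y - η‖ := by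
          rw [add_comm, norm_sub_rev (moeb γ.1 y) η]
          exact norm_sub_le_norm_sub_add_norm_sub _ _ _
        have d3 : c⁻¹ * 3 / 4 ≤ ‖moeb γ.1 y - ξ‖ := by linarith
        have d4 := mul_le_mul_of_nonneg_left d3 hκn
        have d5 : t / 2 * ‖κ.1 1 0‖ ≤ c⁻¹ / 4 * ‖κ.1 1 0‖ :=
          mul_le_mul_of_nonneg_right (by linarith) hκn
        linarith
      have a2 : c / 2 ≤ ‖moebDen γ.1 y‖ * ‖γ.1 1 0‖ := by
        have d1 := norm_moeb_sub_moebInf (hΓ.norm_lowerLeft_inv γ hr.mem) hγ0 hr.moebDen_ne_zero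
        have d2 : ‖moeb γ.1 y - moebInf γ.1‖ ≤ 2 * c⁻¹ := by
          have : moeb γ.1 y - moebInf γ.1 =
            (moeb γ.1 y - η) + (η - ξ) - (moebInf γ.1 - ξ) := by abel
          have e1 := norm_sub_le ((moeb γ.1 y - η) + (η - ξ)) (moebInf γ.1 - ξ)
          rw [← this] at e1
          have e2 := norm_add_le (moeb γ.1 y - η) (η - ξ)
          linarith [hr.moebInf_near]
        have d3 : 0 ≤ cuspDist γ.1 y := by rw [cuspDist]; positivity
        have d4 := mul_le_mul_of_nonneg_right d2 d3
        rw [d1] at d4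
        have d5 := mul_le_mul_of_nonneg_left d4 hc.le
        have d6 : c * (2 * c⁻¹ * cuspDist γ.1 y) = 2 * cuspDist γ.1 y := by
          rw [← mul_assoc, mul_left_comm, hcL]; ring
        rw [d6, cuspDist] at d5
        linarith
      have a3 := mul_le_mul a1 a2 (by positivity) (norm_nonneg _)
      have a4 : c⁻¹ / 2 * ‖κ.1 1 0‖ * (c / 2) = ‖κ.1 1 0‖ / 4 := by
        rw [show c⁻¹ / 2 * ‖κ.1 1 0‖ * (c / 2) = (c * c⁻¹) * (‖κ.1 1 0‖ / 4) by ring, hcL, one_mul]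
      rw [a4] at a3
      linarith
    have b4 : ‖k.1 1 0‖ * ‖y - Y‖ ≤ 16 * c * t * ‖moebDen k.1 y‖ := by
      refine le_of_mul_le_mul_right ?_ hγ
      calc ‖k.1 1 0‖ * ‖y - Y‖ * ‖γ.1 1 0‖
          ≤ t * ‖κ.1 1 0‖ * ‖γ.1 1 0‖ * ‖y - Y‖ * ‖γ.1 1 0‖ := by gcongr
        _ = t * ‖κ.1 1 0‖ * (‖γ.1 1 0‖ * ‖y - Y‖ * ‖γ.1 1 0‖) := by ring
        _ ≤ t * (4 * (‖moebDen k.1 y‖ * ‖γ.1 1 0‖)) * (4 * c) := by gcongr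
        _ = _ := by ring
    have b5 := norm_moebDen_le k.1 y Y
    have b6 : 0 ≤ t * ‖moebDen k.1 y‖ := by positivity
    linarith
  have hA : 0 ≤ 1 - (18 + 16 * c) * t := by linarith
  calc (1 - (18 + 16 * c) * t) ^ 2 * ((c - t ^ 2) * ‖y - w‖)
      ≤ (1 - (18 + 16 * c) * t) ^ 2 * (‖moebDen k.1 w‖ * ‖moebDen k.1 y‖) :=
        mul_le_mul_of_nonneg_left (hr.lower k hk hkξ) (sq_nonneg _)
    _ = ((1 - (18 + 16 * c) * t) * ‖moebDen k.1 w‖) *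
        ((1 - (18 + 16 * c) * t) * ‖moebDen k.1 y‖) := by ring
    _ ≤ _ := by gcongr

end Return

/-- The products `γ (n - 1) * ⋯ * γ 0`. -/
def forwardProd {G : Type*} [Group G] (γ : ℕ → G) : ℕ → G
  | 0 => 1
  | n + 1 => γ n * forwardProd γ n

/-- The compositions of the Möbius actions of `(γ 0)⁻¹, …, (γ (n - 1))⁻¹`. -/
def backwardMoeb (γ : ℕ → (Matrix (Fin 2) (Fin 2) D)ˣ) : ℕ → D → D
  | 0 => id
  | n + 1 => backwardMoeb γ n ∘ moeb ((γ n)⁻¹).1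

theorem exists_forward_orbit_mem {B : Set D} (hB : IsCompact B) (hne : B.Nonempty)
    (γ : ℕ → (Matrix (Fin 2) (Fin 2) D)ˣ)
    (h : ∀ n, ∀ z ∈ B, moebDen ((γ n)⁻¹).1 z ≠ 0 ∧ moeb ((γ n)⁻¹).1 z ∈ B) :
    ∃ x, ∀ n, moebDen (forwardProd γ n).1 x ≠ 0 ∧ moeb (forwardProd γ n).1 x ∈ B := by
  have hcont : ∀ n, ContinuousOn (backwardMoeb γ n) B := by
    intro n
    induction n with
    | zero => exact continuousOn_id
    | succ n ih =>
      exact ih.comp (fun z hz => (continuousAt_moeb _ (h n z hz).1).continuousWithinAt)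
        (fun z hz => (h n z hz).2)
  have hcomp : ∀ n, IsCompact (backwardMoeb γ n '' B) := fun n => hB.image_of_continuousOn (hcont n)
  obtain ⟨x, hx⟩ := IsCompact.nonempty_iInter_of_sequence_nonempty_isCompact_isClosed
    (fun n => backwardMoeb γ n '' B)
    (fun n => by
      rintro _ ⟨z, hz, rfl⟩
      exact ⟨moeb ((γ n)⁻¹).1 z, (h n z hz).2, rfl⟩)
    (fun n => hne.image _) (hcomp 0) (fun n => (hcomp n).isClosed)
  have hback : ∀ n, ∀ z ∈ B, backwardMoeb γ n z = x →
      moebDen (forwardProd γ n).1 x ≠ 0 ∧ moeb (forwardProd γ n).1 x = z := by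
    intro n
    induction n with
    | zero =>
      rintro z - rfl
      simp [forwardProd, backwardMoeb, moebDen_one, moeb_one]
    | succ n ih =>
      intro z hz hzx
      obtain ⟨h1, h2⟩ := ih _ (h n z hz).2 hzx
      rw [forwardProd, Units.val_mul, moebDen_mul _ _ h1, moeb_mul _ _ h1, h2,
        moeb_moeb_inv (h n z hz).1]
      exact ⟨mul_ne_zero (moebDen_moeb_inv (h n z hz).1) h1, rfl⟩
  refine ⟨x, fun n => ?_⟩
  obtain ⟨z, hz, hzx⟩ := Set.mem_iInter.1 hx n
  obtain ⟨h1, h2⟩ := hback n z hz hzx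
  exact ⟨h1, h2 ▸ hz⟩

theorem tendsto_cuspLowerBound (hc : 0 < c) {t : ℕ → ℝ} (ht : Tendsto t atTop (𝓝 0)) :
    Tendsto (fun n => (1 - (18 + 16 * c) * t n) ^ 2 * ((c - t n ^ 2) * (c⁻¹ - 2 * t n ^ 2)) /
      (c⁻¹ + 10 * t n ^ 2)) atTop (𝓝 c) := by
  have hcont : ContinuousAt (fun s : ℝ => (1 - (18 + 16 * c) * s) ^ 2 *
      ((c - s ^ 2) * (c⁻¹ - 2 * s ^ 2)) / (c⁻¹ + 10 * s ^ 2)) 0 := by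
    refine ContinuousAt.div (by fun_prop) (by fun_prop) ?_
    simpa using hc.ne'
  have := hcont.tendsto.comp ht
  have e : (1 - (18 + 16 * c) * 0) ^ 2 * ((c - 0 ^ 2) * (c⁻¹ - 2 * 0 ^ 2)) /
      (c⁻¹ + 10 * 0 ^ 2) = c := by
    norm_num
  rw [e] at this
  exact this

theorem exists_isAlmostCuspLiminf [ProperSpace D] (hΓ : IsCuspGroup Γ) {R : ℝ}
    (hR : HasTranslations Γ R) (hc : 0 < c) (H : ∀ ε > 0, ∃ x, IsAlmostCuspLiminf Γ c ε x) :
    ∃ x, ∀ ε > 0, IsAlmostCuspLiminf Γ c ε x := by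
  have hcL : c * c⁻¹ = 1 := mul_inv_cancel₀ hc.ne'
  have hLpos : 0 < c⁻¹ := inv_pos.2 hc
  obtain ⟨ξ, η, hξη, hlim⟩ := exists_common_limitPair hΓ hR hc H
  obtain ⟨t₀, ht₀, ht₀1, ht₀L, ht₀c, ht₀A⟩ : ∃ t₀ : ℝ, 0 < t₀ ∧ t₀ ≤ 1 / 100 ∧
      t₀ ≤ c⁻¹ / 100 ∧ t₀ ≤ c / 2 ∧ t₀ ≤ 1 / (18 + 16 * c) := by
    refine ⟨min (1 / 100) (min (c⁻¹ / 100) (min (c / 2) (1 / (18 + 16 * c)))), ?_, ?_, ?_, ?_, ?_⟩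
    · positivity
    · exact min_le_left _ _
    · exact (min_le_right _ _).trans (min_le_left _ _)
    · exact (min_le_right _ _).trans ((min_le_right _ _).trans (min_le_left _ _))
    · exact (min_le_right _ _).trans ((min_le_right _ _).trans (min_le_right _ _))
  set t : ℕ → ℝ := fun n => t₀ * (1 / 2) ^ n with htdef
  have ht : ∀ n, 0 < t n := fun n => by positivity
  have htsucc : ∀ n, t (n + 1) = t n / 2 := fun n => by simp only [htdef, pow_succ]; ring
  have htle : ∀ n, t n ≤ t₀ := fun n => by
    have : ((1 : ℝ) / 2) ^ n ≤ 1 := pow_le_one₀ (by norm_num) (by norm_num)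
    simp only [htdef]; nlinarith
  have htlim : Tendsto t atTop (𝓝 0) := by
    have := (tendsto_pow_atTop_nhds_zero_of_lt_one (r := (1 / 2 : ℝ)) (by norm_num)
      (by norm_num)).const_mul t₀
    rwa [mul_zero] at this
  have ht1 : ∀ n, t n ≤ 1 / 100 := fun n => (htle n).trans ht₀1
  have htL : ∀ n, t n ≤ c⁻¹ / 100 := fun n => (htle n).trans ht₀L
  have htA : ∀ n, (18 + 16 * c) * t n ≤ 1 := fun n => by
    have := (htle n).trans ht₀A
    rwa [le_div_iff₀ (by positivity), mul_comm] at this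
  have htsq : ∀ n, t n ^ 2 ≤ t n / 100 := fun n => by nlinarith [ht n, ht1 n]
  clear_value t
  choose w y γ hr using fun n => exists_isReturn hΓ hc hξη hlim (ht n) (ht1 n) (htL n)
    ((htle n).trans ht₀c)
  obtain ⟨x, hx⟩ := exists_forward_orbit_mem
    (B := {z | ‖z - η‖ ≤ c⁻¹ / 8})
    (by simpa [Metric.closedBall, dist_eq_norm] using isCompact_closedBall η (c⁻¹ / 8))
    ⟨η, by simpa using (by positivity : 0 ≤ c⁻¹ / 8)⟩ γ
    (fun n z hz => (hr n).preimage hΓ hc hξη (ht n) (ht1 n) (htL n) hz)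
  obtain ⟨g, hg⟩ : ∃ g, g = forwardProd γ := ⟨_, rfl⟩
  rw [← hg] at hx
  have hgsucc : ∀ n, (g (n + 1)).1 = (γ n).1 * (g n).1 := fun n => by
    rw [hg, forwardProd, Units.val_mul]
  have hgmem : ∀ n, g n ∈ Γ := by
    intro n
    induction n with
    | zero => rw [hg]; exact Γ.one_mem
    | succ n ih => rw [hg, forwardProd, ← hg]; exact Γ.mul_mem (hr n).mem ih
  set Y : ℕ → D := fun n => moeb (g n).1 x with hYdef
  have hYsucc : ∀ n, Y (n + 1) = moeb (γ n).1 (Y n) := fun n => by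
    simp only [hYdef]; rw [hgsucc, moeb_mul _ _ (hx n).1]
  have hYden : ∀ n, moebDen (γ n).1 (Y n) ≠ 0 := fun n => by
    have := (hx (n + 1)).1
    rw [hgsucc, moebDen_mul _ _ (hx n).1] at this
    exact left_ne_zero_of_mul this
  have hYmem : ∀ n, ‖moeb (γ n).1 (Y n) - η‖ ≤ c⁻¹ / 8 := fun n => by
    rw [← hYsucc]; exact (hx (n + 1)).2
  have hYη : ∀ n, ‖Y n - η‖ ≤ 2 * t n ^ 2 := fun n =>
    ((hr n).contract hΓ hc hξη (ht n) (ht1 n) (htL n) (hYden n) (hYmem n)).2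
  have hW : ∀ n, (g (n + 1)).1 1 0 ≠ 0 ∧ ‖moebInf (g (n + 1)).1 - ξ‖ ≤ 2 * t n ^ 2 ∧
      min 1 (c⁻¹ / 2) ≤ t n ^ 2 * ‖(g (n + 1)).1 1 0‖ := by
    intro n
    induction n with
    | zero =>
      have e : (g 1).1 = (γ 0).1 := by rw [hgsucc, hg, forwardProd, Units.val_one, mul_one]
      rw [zero_add, e]
      exact ⟨norm_pos_iff.1 (hr 0).norm_pos, by linarith [(hr 0).moebInf_near, sq_nonneg (t 0)],
        (min_le_left _ _).trans (hr 0).large⟩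
    | succ n ih =>
      obtain ⟨i1, i2, -⟩ := ih
      obtain ⟨f1, f2⟩ := (hr (n + 1)).forward hΓ hc hξη (ht _) (ht1 _) (htL _)
        (show ‖moebInf (g (n + 1)).1 - ξ‖ ≤ c⁻¹ / 8 by linarith [htsq n, htL n])
      have hγ := (hr (n + 1)).norm_pos
      have hd : 0 < ‖moebDen (γ (n + 1)).1 (moebInf (g (n + 1)).1)‖ :=
        lt_of_lt_of_le (by positivity) f1
      rw [hgsucc, lowerLeft_mul _ _ i1, moebInf_mul _ _ i1]
      refine ⟨mul_ne_zero (norm_pos_iff.1 hd) i1, f2, (min_le_right _ _).trans ?_⟩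
      have a1 := hΓ.one_le_norm_lowerLeft _ (hgmem (n + 1)) i1
      have a2 := (hr (n + 1)).large
      rw [norm_mul]
      calc c⁻¹ / 2 = c⁻¹ / 2 * 1 * 1 := by ring
        _ ≤ c⁻¹ / 2 * (t (n + 1) ^ 2 * ‖(γ (n + 1)).1 1 0‖) * ‖(g (n + 1)).1 1 0‖ := by gcongr
        _ = t (n + 1) ^ 2 * (c⁻¹ / 2 * ‖(γ (n + 1)).1 1 0‖ * ‖(g (n + 1)).1 1 0‖) := by ring
        _ ≤ _ := by gcongr
  -- the same facts, indexed by `n ≥ 1`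
  have hW' : ∀ n, 1 ≤ n → (g n).1 1 0 ≠ 0 ∧ ‖moebInf (g n).1 - ξ‖ ≤ 8 * t n ^ 2 ∧
      min 1 (c⁻¹ / 2) ≤ 4 * t n ^ 2 * ‖(g n).1 1 0‖ := by
    intro n hn
    obtain ⟨m, rfl⟩ := Nat.exists_eq_add_of_le' hn
    obtain ⟨i1, i2, i3⟩ := hW m
    rw [htsucc m]
    exact ⟨i1, i2.trans (le_of_eq (by ring)), i3.trans (le_of_eq (by ring))⟩
  have hdist : ∀ n, 1 ≤ n → ‖Y n - moebInf (g n).1‖ * cuspDist (g n).1 x = 1 := fun n hn =>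
    norm_moeb_sub_moebInf (hΓ.norm_lowerLeft_inv _ (hgmem n)) (hW' n hn).1 (hx n).1
  have hgap : ∀ n, 1 ≤ n → c⁻¹ - 10 * t n ^ 2 ≤ ‖Y n - moebInf (g n).1‖ ∧
      ‖Y n - moebInf (g n).1‖ ≤ c⁻¹ + 10 * t n ^ 2 := by
    intro n hn
    have a0 := (hW' n hn).2.1
    have a1 := norm_sub_le ((Y n - η) + (η - ξ)) (moebInf (g n).1 - ξ)
    have a2 := norm_add_le (Y n - η) (η - ξ)
    rw [show (Y n - η) + (η - ξ) - (moebInf (g n).1 - ξ) = Y n - moebInf (g n).1 by abel] at a1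
    have a3 := norm_add_le ((Y n - moebInf (g n).1) - (Y n - η)) (moebInf (g n).1 - ξ)
    have a4 := norm_sub_le (Y n - moebInf (g n).1) (Y n - η)
    rw [show (Y n - moebInf (g n).1) - (Y n - η) + (moebInf (g n).1 - ξ) = η - ξ by abel] at a3
    constructor <;> linarith [hYη n]
  have hμ : 0 < min 1 (c⁻¹ / 2) := by positivity
  have htop : ∀ T : ℝ, ∀ᶠ n in atTop, t n * T < min 1 (c⁻¹ / 2) := fun T => by
    have := htlim.mul_const T
    rw [zero_mul] at this
    exact this.eventually_lt_const hμ
  have hgtop : Tendsto (fun n => ‖(g n).1 1 0‖) atTop atTop := by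
    refine tendsto_atTop.2 fun T => ?_
    filter_upwards [htop T, eventually_ge_atTop 1] with n hn hn1
    obtain ⟨-, -, i3⟩ := hW' n hn1
    have a1 : 4 * t n ^ 2 * ‖(g n).1 1 0‖ ≤ t n * ‖(g n).1 1 0‖ :=
      mul_le_mul_of_nonneg_right (by linarith [htsq n, ht n]) (norm_nonneg _)
    exact (lt_of_mul_lt_mul_left (hn.trans_le (i3.trans a1)) (ht n).le).le
  have hglim : Tendsto (fun n => cuspDist (g n).1 x) atTop (𝓝 c) := by
    have b : Tendsto (fun n => 10 * t n ^ 2) atTop (𝓝 0) := by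
      have := (htlim.pow 2).const_mul 10
      simpa using this
    have a1 : Tendsto (fun n => c⁻¹ - 10 * t n ^ 2) atTop (𝓝 c⁻¹) := by
      simpa using b.const_sub c⁻¹
    have a2 : Tendsto (fun n => c⁻¹ + 10 * t n ^ 2) atTop (𝓝 c⁻¹) := by
      simpa using b.const_add c⁻¹
    have a3 : Tendsto (fun n => ‖Y n - moebInf (g n).1‖) atTop (𝓝 c⁻¹) :=
      tendsto_of_tendsto_of_tendsto_of_le_of_le' a1 a2
        ((eventually_ge_atTop 1).mono fun n hn => (hgap n hn).1)
        ((eventually_ge_atTop 1).mono fun n hn => (hgap n hn).2)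
    have a4 := a3.inv₀ hLpos.ne'
    rw [inv_inv] at a4
    exact a4.congr' ((eventually_ge_atTop 1).mono fun n hn => inv_eq_of_mul_eq_one_right (hdist n hn))
  have hlower : ∀ ε > 0, ∃ T : ℝ, ∀ h ∈ Γ, T ≤ ‖h.1 1 0‖ → c - ε ≤ cuspDist h.1 x := by
    intro ε hε
    obtain ⟨N, hN⟩ := eventually_atTop.1 (((tendsto_cuspLowerBound hc htlim).eventually_const_le
      (show c - ε < c by linarith)).and (eventually_ge_atTop 1))
    have hN1 : ∀ n, N ≤ n → 1 ≤ n := fun n hn => (hN n hn).2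
    refine ⟨(4 * c + 1) * ‖(g N).1 1 0‖, fun h hh hTh => ?_⟩
    by_contra! hlt
    have hlt' : cuspDist h.1 x < c := by linarith
    obtain ⟨k, hk⟩ : ∃ k : ℕ → (Matrix (Fin 2) (Fin 2) D)ˣ, ∀ n, k n = h * (g n)⁻¹ :=
      ⟨_, fun _ => rfl⟩
    have hkmem : ∀ n, k n ∈ Γ := fun n => hk n ▸ Γ.mul_mem hh (Γ.inv_mem (hgmem n))
    have hkg : ∀ n, h.1 = (k n).1 * (g n).1 := fun n => by
      rw [← Units.val_mul, hk, inv_mul_cancel_right]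
    have hksucc : ∀ n, k (n + 1) = k n * (γ n)⁻¹ := fun n => by
      have : g (n + 1) = γ n * g n := Units.ext (hgsucc n)
      rw [hk, hk, this, mul_inv_rev, mul_assoc]
    have hnorm : ∀ n, N ≤ n →
        ‖h.1 1 0‖ = ‖moebDen (k n).1 (moebInf (g n).1)‖ * ‖(g n).1 1 0‖ := fun n hn => by
      rw [hkg n, lowerLeft_mul _ _ (hW' n (hN1 n hn)).1, norm_mul]
    have hprod : ∀ n, N ≤ n → cuspDist h.1 x * ‖Y n - moebInf (g n).1‖ =
        ‖moebDen (k n).1 (moebInf (g n).1)‖ * ‖moebDen (k n).1 (Y n)‖ := fun n hn => by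
      rw [hkg n, cuspDist_mul _ _ (hW' n (hN1 n hn)).1 (hx n).1, mul_assoc,
        mul_comm (cuspDist (g n).1 x), hdist n (hN1 n hn), mul_one]
    have hgood : t N * ‖(k N).1 1 0‖ ≤ ‖moebDen (k N).1 ξ‖ := by
      by_contra! hbad
      have hgN := norm_pos_iff.2 (hW' N (hN1 N le_rfl)).1
      have hWN := (hW' N (hN1 N le_rfl)).2.1
      have hgapN := hgap N (hN1 N le_rfl)
      have a0 : 4 * c + 1 ≤ ‖moebDen (k N).1 (moebInf (g N).1)‖ := by
        rw [hnorm N le_rfl] at hTh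
        exact le_of_mul_le_mul_right hTh hgN
      have a1 : ‖moebDen (k N).1 (moebInf (g N).1)‖ ≤ 2 * t N * ‖(k N).1 1 0‖ := by
        have b1 := norm_moebDen_le (k N).1 (moebInf (g N).1) ξ
        have b2 := mul_le_mul_of_nonneg_left
          (hWN.trans (show 8 * t N ^ 2 ≤ t N by linarith [htsq N, ht N]))
          (norm_nonneg ((k N).1 1 0))
        linarith
      have a2 : 4 * c + 1 ≤ ‖(k N).1 1 0‖ := by
        have := mul_le_mul_of_nonneg_right (show 2 * t N ≤ 1 by linarith [ht1 N])
          (norm_nonneg ((k N).1 1 0))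
        linarith
      have a3 : c⁻¹ / 2 * ‖(k N).1 1 0‖ ≤ ‖moebDen (k N).1 (Y N)‖ := by
        have b1 := norm_moebDen_sub (k N).1 (Y N) (moebInf (g N).1)
        have b2 := norm_sub_le (moebDen (k N).1 (Y N)) (moebDen (k N).1 (moebInf (g N).1))
        have b3 := mul_le_mul_of_nonneg_left
          (show c⁻¹ / 2 + 2 * t N ≤ ‖Y N - moebInf (g N).1‖ by linarith [htsq N, htL N])
          (norm_nonneg ((k N).1 1 0))
        linarith
      have a4 : c⁻¹ / 2 * (4 * c + 1) ≤ ‖moebDen (k N).1 (Y N)‖ :=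
        (mul_le_mul_of_nonneg_left a2 (by positivity)).trans a3
      have a5 : c⁻¹ / 2 * (4 * c + 1) = 2 + c⁻¹ / 2 := by
        linear_combination 2 * hcL
      have a6 : cuspDist h.1 x * ‖Y N - moebInf (g N).1‖ ≤ c * (2 * c⁻¹) :=
        mul_le_mul hlt'.le (by linarith [htsq N, htL N]) (norm_nonneg _) hc.le
      have a7 : 1 * (2 + c⁻¹ / 2) ≤
          ‖moebDen (k N).1 (moebInf (g N).1)‖ * ‖moebDen (k N).1 (Y N)‖ :=
        mul_le_mul (by linarith) (a5 ▸ a4) (by positivity) (norm_nonneg _)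
      rw [← hprod N le_rfl] at a7
      linarith
    obtain ⟨m, hNm, hbad⟩ : ∃ m, N ≤ m ∧ ‖moebDen (k m).1 ξ‖ < t m * ‖(k m).1 1 0‖ := by
      obtain ⟨m, hm, hNm⟩ := ((htop (8 * ‖h.1 1 0‖)).and (eventually_ge_atTop N)).exists
      refine ⟨m, hNm, ?_⟩
      by_contra! hg'
      obtain ⟨-, i2, i3⟩ := hW' m (hN1 m hNm)
      have a1 := hΓ.le_norm_moebDen (hkmem m) (ht m).le (by linarith [ht1 m]) hg'
      have a2 : t m / 2 ≤ ‖moebDen (k m).1 (moebInf (g m).1)‖ := by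
        have b1 := norm_moebDen_le (k m).1 ξ (moebInf (g m).1)
        rw [norm_sub_rev] at b1
        have b2 := mul_le_mul_of_nonneg_left
          (i2.trans (show 8 * t m ^ 2 ≤ t m / 2 by linarith [htsq m, ht m]))
          (norm_nonneg ((k m).1 1 0))
        linarith
      have a3 := mul_le_mul_of_nonneg_right a2 (norm_nonneg ((g m).1 1 0))
      rw [← hnorm m hNm] at a3
      have a4 := mul_le_mul_of_nonneg_left a3 (ht m).le
      have a5 : 4 * t m ^ 2 * ‖(g m).1 1 0‖ = 8 * (t m * (t m / 2 * ‖(g m).1 1 0‖)) := by ring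
      linarith
    obtain ⟨n, hNn, hn, hn'⟩ : ∃ n, N ≤ n ∧ t n * ‖(k n).1 1 0‖ ≤ ‖moebDen (k n).1 ξ‖ ∧
        ‖moebDen (k (n + 1)).1 ξ‖ < t (n + 1) * ‖(k (n + 1)).1 1 0‖ := by
      by_contra! hcon
      exact absurd (Nat.le_induction (P := fun n _ => t n * ‖(k n).1 1 0‖ ≤ ‖moebDen (k n).1 ξ‖)
        hgood (fun n hn ih => hcon n hn ih) m hNm) (not_le.2 hbad)
    rw [hksucc, htsucc] at hn'
    have hcomp := (hr n).compare hΓ hc hξη (ht n) (ht1 n) (htL n) (htA n)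
      (hW' n (hN1 n hNn)).2.1 (hYden n) (hYmem n) (hkmem n) hn hn'
    rw [← hprod n hNn] at hcomp
    have hwy : c⁻¹ - 2 * t n ^ 2 ≤ ‖y n - w n‖ := by
      have a1 := norm_sub_le (y n - w n) (y n - η)
      have a2 := norm_add_le ((y n - w n) - (y n - η)) (w n - ξ)
      rw [show (y n - w n) - (y n - η) + (w n - ξ) = η - ξ by abel] at a2
      linarith [(hr n).left_near, (hr n).right_near]
    have hpos : 0 < c⁻¹ + 10 * t n ^ 2 := by positivity
    have hbound := (hN n hNn).1
    have hct : 0 ≤ c - t n ^ 2 := by linarith [htsq n, htle n, ht n]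
    have hup : (1 - (18 + 16 * c) * t n) ^ 2 * ((c - t n ^ 2) * (c⁻¹ - 2 * t n ^ 2)) ≤
        cuspDist h.1 x * (c⁻¹ + 10 * t n ^ 2) :=
      (mul_le_mul_of_nonneg_left (mul_le_mul_of_nonneg_left hwy hct) (sq_nonneg _)).trans
        (hcomp.trans (mul_le_mul_of_nonneg_left (hgap n (hN1 n hNn)).2
          (mul_nonneg (norm_nonneg _) (norm_nonneg _))))
    exact absurd (hbound.trans ((div_le_iff₀ hpos).2 hup)) (not_le.2 hlt)
  refine ⟨x, fun ε hε => ⟨hlower ε hε, fun T => ?_⟩⟩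
  obtain ⟨n, h1, h2⟩ := ((hgtop.eventually_ge_atTop T).and
    (hglim.eventually_le_const (show c < c + ε by linarith))).exists
  exact ⟨g n, hgmem n, h1, h2⟩

end CuspGroup

section Order

/-- An order in a rational form of the Hamilton quaternions is the `ℤ`-span of a real basis. -/
theorem exists_basis_mem_iff_mem_span_int (A : Subalgebra ℚ (Quaternion ℝ))
    (hAdim : Module.finrank ℚ A = 4)
    (hAspan : Submodule.span ℝ (A : Set (Quaternion ℝ)) = ⊤)
    (O' : Subring (Quaternion ℝ))
    (hO'A : (O' : Set (Quaternion ℝ)) ⊆ A)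
    (hO'fg : ∃ s : Finset (Quaternion ℝ), ↑s ⊆ (O' : Set (Quaternion ℝ)) ∧
      ∀ x ∈ O', x ∈ Submodule.span ℤ (s : Set (Quaternion ℝ)))
    (hO'span : ∀ x ∈ A, x ∈ Submodule.span ℚ (O' : Set (Quaternion ℝ))) :
    ∃ b : Module.Basis (Fin 4) ℝ (Quaternion ℝ),
      ∀ x, x ∈ O' ↔ x ∈ Submodule.span ℤ (Set.range b) := by
  obtain ⟨s, hsO, hs⟩ := hO'fg
  set M : Submodule ℤ (Quaternion ℝ) := O'.toAddSubgroup.toIntSubmodule with hM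
  have memM : ∀ x, x ∈ M ↔ x ∈ O' := fun x => Iff.rfl
  have hMs : M = Submodule.span ℤ (s : Set (Quaternion ℝ)) :=
    le_antisymm (fun x hx => hs x hx) (Submodule.span_le.2 fun x hx => hsO hx)
  have : Module.Finite ℤ M := Module.Finite.iff_fg.2 ⟨s, hMs.symm⟩
  have : IsAddTorsionFree (Quaternion ℝ) := .of_module_rat _
  let β := Module.Free.chooseBasis ℤ M
  let v : Module.Free.ChooseBasisIndex ℤ M → Quaternion ℝ := fun i => (β i : Quaternion ℝ)
  have hvspan : Submodule.span ℤ (Set.range v) = M := by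
    have := congrArg (Submodule.map M.subtype) β.span_eq
    rw [Submodule.map_span, ← Set.range_comp, Submodule.map_top, Submodule.range_subtype] at this
    exact this
  have hvind : LinearIndependent ℤ v := β.linearIndependent.map' M.subtype (by simp)
  have hvindQ : LinearIndependent ℚ v := hvind.localization ℚ (nonZeroDivisors ℤ)
  have hspan : ∀ x ∈ A, x ∈ Submodule.span ℚ (Set.range v) := by
    intro x hx
    refine Submodule.span_le.2 (fun y hy => ?_) (hO'span x hx)
    have : y ∈ Submodule.span ℤ (Set.range v) := by rw [hvspan]; exact hy
    exact Submodule.span_le_restrictScalars ℤ ℚ _ this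
  have hAv : Subalgebra.toSubmodule A = Submodule.span ℚ (Set.range v) :=
    le_antisymm hspan (Submodule.span_le.2 (by
      rintro _ ⟨i, rfl⟩
      exact hO'A (β i).2))
  have hcard : Fintype.card (Module.Free.ChooseBasisIndex ℤ M) = 4 := by
    have h1 := finrank_span_eq_card hvindQ
    rw [← hAv] at h1
    rw [← h1]
    exact hAdim
  have htop : ⊤ ≤ Submodule.span ℝ (Set.range v) := by
    rw [← hAspan]
    exact Submodule.span_le.2 fun x hx => Submodule.span_le_restrictScalars ℚ ℝ _ (hspan x hx)
  let e := Fintype.equivFinOfCardEq hcard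
  refine ⟨(basisOfTopLeSpanOfCardEqFinrank v htop
    (by rw [hcard, Quaternion.finrank_eq_four])).reindex e, fun x => ?_⟩
  rw [Module.Basis.range_reindex, coe_basisOfTopLeSpanOfCardEqFinrank, hvspan]
  exact (memM x).symm

variable {O' : Subring (Quaternion ℝ)} {b : Module.Basis (Fin 4) ℝ (Quaternion ℝ)}

theorem one_le_norm_of_mem_order (hb : ∀ x, x ∈ O' ↔ x ∈ Submodule.span ℤ (Set.range b))
    {x : Quaternion ℝ} (hx : x ∈ O') (hx0 : x ≠ 0) : 1 ≤ ‖x‖ := by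
  by_contra! hlt
  have hlim : Tendsto (fun n : ℕ => (⟨x ^ n, (hb _).1 (O'.pow_mem hx n)⟩ :
      Submodule.span ℤ (Set.range b))) atTop (𝓝 0) := by
    rw [tendsto_subtype_rng]
    exact tendsto_pow_atTop_nhds_zero_of_norm_lt_one hlt
  rw [nhds_discrete, tendsto_pure] at hlim
  obtain ⟨n, hn⟩ := hlim.exists
  exact pow_ne_zero n hx0 (congrArg Subtype.val hn)

theorem exists_int_eq_of_coe_mem_order (hb : ∀ x, x ∈ O' ↔ x ∈ Submodule.span ℤ (Set.range b))
    {r : ℝ} (hr : (r : Quaternion ℝ) ∈ O') : ∃ m : ℤ, r = m := by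
  refine ⟨⌊r⌋, ?_⟩
  have h1 : ((Int.fract r : ℝ) : Quaternion ℝ) ∈ O' := by
    rw [Int.fract, Quaternion.coe_sub, Quaternion.coe_intCast]
    exact O'.sub_mem hr (intCast_mem O' _)
  by_contra h
  have h2 := one_le_norm_of_mem_order hb h1 (by
    rw [Ne, ← Quaternion.coe_zero, Quaternion.coe_inj, Int.fract]
    exact fun h' => h (sub_eq_zero.1 h'))
  rw [Quaternion.norm_coe, Real.norm_of_nonneg (Int.fract_nonneg r)] at h2
  exact absurd (Int.fract_lt_one r) (not_lt.2 h2)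

theorem exists_int_smul_mem_order {x : Quaternion ℝ}
    (hx : x ∈ Submodule.span ℚ (O' : Set (Quaternion ℝ))) :
    ∃ m : ℤ, m ≠ 0 ∧ (m : Quaternion ℝ) * x ∈ O' := by
  induction hx using Submodule.span_induction with
  | mem x hx => exact ⟨1, one_ne_zero, by simpa using hx⟩
  | zero => exact ⟨1, one_ne_zero, by simp⟩
  | add x y _ _ hx hy =>
    obtain ⟨m, hm, hx⟩ := hx
    obtain ⟨n, hn, hy⟩ := hy
    refine ⟨m * n, mul_ne_zero hm hn, ?_⟩
    have e : ((m * n : ℤ) : Quaternion ℝ) * (x + y) =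
        (n : Quaternion ℝ) * ((m : Quaternion ℝ) * x) +
          (m : Quaternion ℝ) * ((n : Quaternion ℝ) * y) := by
      rw [mul_add, ← mul_assoc, ← mul_assoc, ← Int.cast_mul, ← Int.cast_mul, mul_comm n m]
    rw [e]
    exact O'.add_mem (O'.mul_mem (intCast_mem O' _) hx) (O'.mul_mem (intCast_mem O' _) hy)
  | smul q x _ hx =>
    obtain ⟨m, hm, hx⟩ := hx
    refine ⟨q.den * m, mul_ne_zero (by exact_mod_cast q.den_nz) hm, ?_⟩
    have e : ((q.den * m : ℤ) : Quaternion ℝ) * (q • x) =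
        (q.num : Quaternion ℝ) * ((m : Quaternion ℝ) * x) := by
      rw [mul_smul_comm, ← zsmul_eq_mul, ← zsmul_eq_mul, ← zsmul_eq_mul, smul_smul,
        ← Int.cast_smul_eq_zsmul ℚ, ← Int.cast_smul_eq_zsmul ℚ, smul_smul]
      congr 1
      push_cast
      rw [← mul_assoc, Rat.mul_den_eq_num]
    rw [e]
    exact O'.mul_mem (intCast_mem O' _) hx

theorem trace_mulLeft_quaternion (x : Quaternion ℝ) :
    LinearMap.trace ℝ (Quaternion ℝ) (LinearMap.mulLeft ℝ x) = 4 * x.re := by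
  let β : Module.Basis (Fin 4) ℝ (Quaternion ℝ) := QuaternionAlgebra.basisOneIJK (-1) 0 (-1)
  have hrepr : ∀ y : Quaternion ℝ, β.repr y = ![y.re, y.imI, y.imJ, y.imK] := fun y =>
    QuaternionAlgebra.coe_basisOneIJK_repr _ _ _ y
  have hβ : ∀ i, ![(β i).re, (β i).imI, (β i).imJ, (β i).imK] = Finsupp.single i (1 : ℝ) :=
    fun i => by rw [← β.repr_self, hrepr]
  have hdiag : ∀ i, LinearMap.toMatrix β β (LinearMap.mulLeft ℝ x) i i = x.re := by
    intro i
    rw [LinearMap.toMatrix_apply, LinearMap.mulLeft_apply, hrepr]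
    have h0 := congrFun (hβ i) 0
    have h1 := congrFun (hβ i) 1
    have h2 := congrFun (hβ i) 2
    have h3 := congrFun (hβ i) 3
    fin_cases i <;> simp_all
  rw [LinearMap.trace_eq_matrix_trace ℝ β, Matrix.trace]
  simp only [Matrix.diag_apply, hdiag, Finset.sum_const, Finset.card_univ, Fintype.card_fin]
  simp

theorem exists_int_eq_four_mul_re (hb : ∀ x, x ∈ O' ↔ x ∈ Submodule.span ℤ (Set.range b))
    {x : Quaternion ℝ} (hx : x ∈ O') : ∃ k : ℤ, 4 * x.re = k := by
  have hmem : ∀ i, ∃ k : ℤ, LinearMap.toMatrix b b (LinearMap.mulLeft ℝ x) i i = k := fun i => by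
    have h1 : x * b i ∈ Submodule.span ℤ (Set.range b) :=
      (hb _).1 (O'.mul_mem hx ((hb _).2 (Submodule.subset_span ⟨i, rfl⟩)))
    obtain ⟨k, hk⟩ := (b.mem_span_iff_repr_mem ℤ _).1 h1 i
    exact ⟨k, by rw [LinearMap.toMatrix_apply, LinearMap.mulLeft_apply, ← hk]; rfl⟩
  choose k hk using hmem
  refine ⟨∑ i, k i, ?_⟩
  rw [← trace_mulLeft_quaternion, LinearMap.trace_eq_matrix_trace ℝ b, Matrix.trace]
  simp only [Matrix.diag_apply, hk, Int.cast_sum]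

theorem star_mem_order (hb : ∀ x, x ∈ O' ↔ x ∈ Submodule.span ℤ (Set.range b))
    {x : Quaternion ℝ} (hx : x ∈ O') : star x ∈ O' := by
  obtain ⟨k, hk⟩ := exists_int_eq_four_mul_re hb hx
  obtain ⟨j, hj⟩ := exists_int_eq_four_mul_re hb (O'.mul_mem hx hx)
  obtain ⟨l, hl⟩ := exists_int_eq_four_mul_re hb (O'.mul_mem hx (O'.mul_mem hx hx))
  have hrel : 8 * l = 6 * k * j - k ^ 3 := by
    have : (8 * l : ℝ) = 6 * k * j - k ^ 3 := by
      rw [← hk, ← hj, ← hl]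
      simp only [Quaternion.re_mul, Quaternion.imI_mul, Quaternion.imJ_mul, Quaternion.imK_mul]
      ring
    exact_mod_cast this
  have hkeven : Even k := by
    have : Even (k ^ 3) := by
      rw [show k ^ 3 = 2 * (3 * k * j - 4 * l) by linarith]
      exact even_two_mul _
    exact (Int.even_pow.1 this).1
  obtain ⟨m, rfl⟩ := hkeven
  have hstar : star x = (m : Quaternion ℝ) - x := by
    have : (2 * x.re : ℝ) = m := by push_cast at hk; linarith
    rw [Quaternion.star_eq_two_re_sub, ← Quaternion.coe_intCast, ← this]
  rw [hstar]
  exact O'.sub_mem (intCast_mem O' _) hx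

end Order

section UnitGroup

variable {O' : Subring (Quaternion ℝ)}

/-- The elements of the two-sided ideal `I'` of the order `O'`, seen as quaternions. -/
def idealSet (I' : TwoSidedIdeal O') : Set (Quaternion ℝ) := {x | ∃ a ∈ I', (a : Quaternion ℝ) = x}

variable {I' : TwoSidedIdeal O'}

theorem zero_mem_idealSet : (0 : Quaternion ℝ) ∈ idealSet I' := ⟨0, I'.zero_mem, rfl⟩

theorem add_mem_idealSet {x y : Quaternion ℝ} (hx : x ∈ idealSet I') (hy : y ∈ idealSet I') :
    x + y ∈ idealSet I' := by
  obtain ⟨a, ha, rfl⟩ := hx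
  obtain ⟨b, hb, rfl⟩ := hy
  exact ⟨a + b, I'.add_mem ha hb, rfl⟩

theorem sub_mem_idealSet {x y : Quaternion ℝ} (hx : x ∈ idealSet I') (hy : y ∈ idealSet I') :
    x - y ∈ idealSet I' := by
  obtain ⟨a, ha, rfl⟩ := hx
  obtain ⟨b, hb, rfl⟩ := hy
  exact ⟨a - b, I'.sub_mem ha hb, rfl⟩

theorem mul_mem_idealSet_left {x y : Quaternion ℝ} (hx : x ∈ O') (hy : y ∈ idealSet I') :
    x * y ∈ idealSet I' := by
  obtain ⟨b, hb, rfl⟩ := hy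
  exact ⟨⟨x, hx⟩ * b, I'.mul_mem_left _ _ hb, rfl⟩

theorem mul_mem_idealSet_right {x y : Quaternion ℝ} (hx : x ∈ idealSet I') (hy : y ∈ O') :
    x * y ∈ idealSet I' := by
  obtain ⟨a, ha, rfl⟩ := hx
  exact ⟨a * ⟨y, hy⟩, I'.mul_mem_right _ _ ha, rfl⟩

theorem mem_of_mem_idealSet {x : Quaternion ℝ} (hx : x ∈ idealSet I') : x ∈ O' := by
  obtain ⟨a, -, rfl⟩ := hx
  exact a.2

theorem norm_eq_one_of_mul_eq_one (hO : ∀ x ∈ O', x ≠ 0 → 1 ≤ ‖x‖) {x y : Quaternion ℝ}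
    (hx : x ∈ O') (hy : y ∈ O') (hxy : x * y = 1) : ‖x‖ = 1 ∧ ‖y‖ = 1 := by
  have h1 := hO x hx (left_ne_zero_of_mul_eq_one hxy)
  have h2 := hO y hy (right_ne_zero_of_mul_eq_one hxy)
  have h3 := congrArg norm hxy
  rw [norm_mul, norm_one] at h3
  constructor <;> nlinarith

/-- The predicate defining the group of two by two matrices over the order `O'`, of
determinant of norm one, with lower left entry in `I'`. -/
structure IsCuspMatrix (I' : TwoSidedIdeal O') (g : (Matrix (Fin 2) (Fin 2) (Quaternion ℝ))ˣ) :
    Prop where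
  mem : ∀ i j, g.1 i j ∈ O'
  lowerLeft_mem : g.1 1 0 ∈ idealSet I'
  mem_inv : ∀ i j, (g⁻¹).1 i j ∈ O'
  lowerLeft_inv_mem : (g⁻¹).1 1 0 ∈ idealSet I'
  norm_lowerLeft : ‖g.1 1 0‖ = ‖(g⁻¹).1 1 0‖

variable {g h : (Matrix (Fin 2) (Fin 2) (Quaternion ℝ))ˣ}

theorem IsCuspMatrix.inv (hg : IsCuspMatrix I' g) : IsCuspMatrix I' g⁻¹ where
  mem := hg.mem_inv
  lowerLeft_mem := hg.lowerLeft_inv_mem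
  mem_inv := by rw [inv_inv]; exact hg.mem
  lowerLeft_inv_mem := by rw [inv_inv]; exact hg.lowerLeft_mem
  norm_lowerLeft := by rw [inv_inv]; exact hg.norm_lowerLeft.symm

theorem IsCuspMatrix.norm_diag (hO : ∀ x ∈ O', x ≠ 0 → 1 ≤ ‖x‖) (hg : IsCuspMatrix I' g)
    (hc : g.1 1 0 = 0) : ‖g.1 0 0‖ = 1 ∧ ‖g.1 1 1‖ = 1 := by
  have hc' : (g⁻¹).1 1 0 = 0 := by
    rw [← norm_eq_zero, ← hg.norm_lowerLeft, hc, norm_zero]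
  have h0 : (g.1 * (g⁻¹).1) 0 0 = 1 := by simp
  have h1 : (g.1 * (g⁻¹).1) 1 1 = 1 := by simp
  rw [Matrix.mul_apply, Fin.sum_univ_two, hc', mul_zero, add_zero] at h0
  rw [Matrix.mul_apply, Fin.sum_univ_two, hc, zero_mul, zero_add] at h1
  exact ⟨(norm_eq_one_of_mul_eq_one hO (hg.mem _ _) (hg.mem_inv _ _) h0).1,
    (norm_eq_one_of_mul_eq_one hO (hg.mem _ _) (hg.mem_inv _ _) h1).1⟩

theorem IsCuspMatrix.norm_lowerLeft_mul (hO : ∀ x ∈ O', x ≠ 0 → 1 ≤ ‖x‖)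
    (hg : IsCuspMatrix I' g) (hh : IsCuspMatrix I' h) :
    ‖(g.1 * h.1) 1 0‖ = ‖((h⁻¹).1 * (g⁻¹).1) 1 0‖ := by
  by_cases hcg : g.1 1 0 = 0
  · have hcg' : (g⁻¹).1 1 0 = 0 := by rw [← norm_eq_zero, ← hg.norm_lowerLeft, hcg, norm_zero]
    rw [Matrix.mul_apply, Fin.sum_univ_two, Matrix.mul_apply, Fin.sum_univ_two, hcg, hcg',
      zero_mul, zero_add, mul_zero, add_zero, norm_mul, norm_mul, (hg.norm_diag hO hcg).2,
      (hg.inv.norm_diag hO hcg').1, hh.norm_lowerLeft, one_mul, mul_one]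
  by_cases hch : h.1 1 0 = 0
  · have hch' : (h⁻¹).1 1 0 = 0 := by rw [← norm_eq_zero, ← hh.norm_lowerLeft, hch, norm_zero]
    rw [Matrix.mul_apply, Fin.sum_univ_two, Matrix.mul_apply, Fin.sum_univ_two, hch, hch',
      zero_mul, zero_add, mul_zero, add_zero, norm_mul, norm_mul, (hh.norm_diag hO hch).1,
      (hh.inv.norm_diag hO hch').2, hg.norm_lowerLeft, one_mul, mul_one]
  have hcg' : (g⁻¹).1 1 0 ≠ 0 := by rwa [← norm_ne_zero_iff, ← hg.norm_lowerLeft, norm_ne_zero_iff]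
  have e := norm_moebDen_inv hg.inv.norm_lowerLeft hcg' (moebInf h.1)
  rw [inv_inv] at e
  rw [lowerLeft_mul _ _ hch, lowerLeft_mul _ _ hcg', norm_mul, norm_mul, e,
    norm_moebDen_inv hh.norm_lowerLeft hch, norm_sub_rev]
  ring

theorem IsCuspMatrix.mul (hO : ∀ x ∈ O', x ≠ 0 → 1 ≤ ‖x‖) (hg : IsCuspMatrix I' g)
    (hh : IsCuspMatrix I' h) : IsCuspMatrix I' (g * h) where
  mem i j := by
    rw [Units.val_mul, Matrix.mul_apply]
    exact O'.sum_mem fun k _ => O'.mul_mem (hg.mem _ _) (hh.mem _ _)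
  lowerLeft_mem := by
    rw [Units.val_mul, Matrix.mul_apply, Fin.sum_univ_two]
    exact add_mem_idealSet (mul_mem_idealSet_right hg.lowerLeft_mem (hh.mem _ _))
      (mul_mem_idealSet_left (hg.mem _ _) hh.lowerLeft_mem)
  mem_inv i j := by
    rw [mul_inv_rev, Units.val_mul, Matrix.mul_apply]
    exact O'.sum_mem fun k _ => O'.mul_mem (hh.mem_inv _ _) (hg.mem_inv _ _)
  lowerLeft_inv_mem := by
    rw [mul_inv_rev, Units.val_mul, Matrix.mul_apply, Fin.sum_univ_two]
    exact add_mem_idealSet (mul_mem_idealSet_right hh.lowerLeft_inv_mem (hg.mem_inv _ _))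
      (mul_mem_idealSet_left (hh.mem_inv _ _) hg.lowerLeft_inv_mem)
  norm_lowerLeft := by
    rw [mul_inv_rev, Units.val_mul, Units.val_mul, hg.norm_lowerLeft_mul hO hh]

theorem one_apply_mem_order (i j : Fin 2) :
    (1 : Matrix (Fin 2) (Fin 2) (Quaternion ℝ)) i j ∈ O' := by
  rw [Matrix.one_apply]
  split_ifs
  · exact O'.one_mem
  · exact O'.zero_mem

theorem IsCuspMatrix.one : IsCuspMatrix I' 1 where
  mem := one_apply_mem_order
  lowerLeft_mem := by simpa using zero_mem_idealSet
  mem_inv := by rw [inv_one]; exact one_apply_mem_order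
  lowerLeft_inv_mem := by simpa using zero_mem_idealSet
  norm_lowerLeft := by rw [inv_one]

/-- The group of two by two matrices over the order `O'`, of determinant of norm one, with
lower left entry in `I'`. -/
def cuspSubgroup (hO : ∀ x ∈ O', x ≠ 0 → 1 ≤ ‖x‖) (I' : TwoSidedIdeal O') :
    Subgroup (Matrix (Fin 2) (Fin 2) (Quaternion ℝ))ˣ where
  carrier := {g | IsCuspMatrix I' g}
  mul_mem' hg hh := hg.mul hO hh
  one_mem' := IsCuspMatrix.one
  inv_mem' hg := hg.inv

variable {hO : ∀ x ∈ O', x ≠ 0 → 1 ≤ ‖x‖}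

theorem isCuspGroup_cuspSubgroup : IsCuspGroup (cuspSubgroup hO I') where
  norm_lowerLeft_inv _ hg := IsCuspMatrix.norm_lowerLeft hg
  one_le_norm_lowerLeft _ hg hc := hO _ (IsCuspMatrix.mem hg _ _) hc
  norm_lowerRight _ hg hc := (IsCuspMatrix.norm_diag hO hg hc).2

theorem hasTranslations_cuspSubgroup {b : Module.Basis (Fin 4) ℝ (Quaternion ℝ)}
    (hb : ∀ x, x ∈ O' ↔ x ∈ Submodule.span ℤ (Set.range b)) :
    HasTranslations (cuspSubgroup hO I') (∑ i, ‖b i‖) := by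
  intro z
  have hτ : -(ZSpan.floor b z : Quaternion ℝ) ∈ O' := O'.neg_mem ((hb _).2 (ZSpan.floor b z).2)
  obtain ⟨τ, hτz⟩ : ∃ τ, τ = -(ZSpan.floor b z : Quaternion ℝ) := ⟨_, rfl⟩
  rw [← hτz] at hτ
  have hmem : ∀ σ ∈ O', ∀ i j,
      (!![1, σ; 0, 1] : Matrix (Fin 2) (Fin 2) (Quaternion ℝ)) i j ∈ O' := by
    intro σ hσ i j
    fin_cases i <;> fin_cases j <;> simp [hσ]
  refine ⟨⟨!![1, τ; 0, 1], !![1, -τ; 0, 1], by simp [Matrix.one_fin_two], by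
    simp [Matrix.one_fin_two]⟩, ?_, τ, rfl, ?_⟩
  · exact {
      mem := hmem τ hτ
      lowerLeft_mem := zero_mem_idealSet
      mem_inv := hmem (-τ) (O'.neg_mem hτ)
      lowerLeft_inv_mem := zero_mem_idealSet
      norm_lowerLeft := rfl }
  · have := ZSpan.norm_fract_le b z
    rwa [ZSpan.fract_apply, sub_eq_add_neg, ← hτz] at this

end UnitGroup

section AdmissiblePairs

variable {O' : Subring (Quaternion ℝ)}

/-- The set `E_{I'}` of pairs `(p, q)` with `q` in `I'` which occur as first columns of matrices
over `O'` of determinant of norm one. -/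
def admissiblePairs (I' : TwoSidedIdeal O') : Set (O' × O') :=
  {pq : O' × O' | pq.2 ∈ I' ∧
    ∃ r s : O', Quaternion.normSq
      ((pq.2 : Quaternion ℝ) * (r : Quaternion ℝ) -
        (pq.2 : Quaternion ℝ) * (pq.1 : Quaternion ℝ) *
          (pq.2 : Quaternion ℝ)⁻¹ * (s : Quaternion ℝ)) = 1}

variable {I' : TwoSidedIdeal O'}

theorem Quaternion.re_mul_mul_star (q y : Quaternion ℝ) :
    (q * y * star q).re = Quaternion.normSq q * y.re := by
  simp only [Quaternion.re_mul, Quaternion.imI_mul, Quaternion.imJ_mul, Quaternion.imK_mul,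
    Quaternion.re_star, Quaternion.imI_star, Quaternion.imJ_star, Quaternion.imK_star,
    Quaternion.normSq_def']
  ring

/-- The norm of the Dieudonné determinant as a polynomial in the entries. -/
theorem normSq_dieudonne {p q r s : Quaternion ℝ} (hq : q ≠ 0) :
    Quaternion.normSq (q * r - q * p * q⁻¹ * s) =
      Quaternion.normSq q * Quaternion.normSq r + Quaternion.normSq p * Quaternion.normSq s -
        2 * (r * star s * q * star p).re := by
  have hN : Quaternion.normSq q ≠ 0 := Quaternion.normSq_ne_zero.2 hq
  have e : q * r * star (q * p * q⁻¹ * s) =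
      (Quaternion.normSq q)⁻¹ • (q * (r * star s * q * star p) * star q) := by
    rw [Quaternion.inv_def]
    simp only [star_mul, Quaternion.star_smul, star_star, smul_mul_assoc, mul_smul_comm, mul_assoc]
  have h1 : Quaternion.normSq (q * p * q⁻¹ * s) = Quaternion.normSq p * Quaternion.normSq s := by
    simp only [map_mul, map_inv₀]
    field_simp
  rw [sub_eq_add_neg, Quaternion.normSq_add, star_neg, mul_neg, Quaternion.re_neg,
    Quaternion.normSq_neg, h1, e, Quaternion.re_smul, Quaternion.re_mul_mul_star, smul_eq_mul,
    inv_mul_cancel_left₀ hN, map_mul]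
  ring

theorem Quaternion.mul_star_mul_self (x a : Quaternion ℝ) :
    x * star a * a = Quaternion.normSq a • x := by
  rw [mul_assoc, Quaternion.star_mul_self, Quaternion.mul_coe_eq_smul]

theorem Quaternion.re_mul_comm (x y : Quaternion ℝ) : (x * y).re = (y * x).re := by
  simp only [Quaternion.re_mul]
  ring

theorem adjugate_mul_eq_one {p q r s : Quaternion ℝ}
    (h : Quaternion.normSq q * Quaternion.normSq r + Quaternion.normSq p * Quaternion.normSq s -
        2 * (r * star s * q * star p).re = 1) :
    (!![Quaternion.normSq s • star p - star q * s * star r,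
        Quaternion.normSq r • star q - star p * r * star s;
        Quaternion.normSq q • star r - star s * q * star p,
        Quaternion.normSq p • star s - star r * p * star q] :
      Matrix (Fin 2) (Fin 2) (Quaternion ℝ)) * !![p, r; q, s] = 1 := by
  have hdiag : ∀ p q r s : Quaternion ℝ,
      (Quaternion.normSq s • star p - star q * s * star r) * p +
      (Quaternion.normSq r • star q - star p * r * star s) * q =
      ((Quaternion.normSq q * Quaternion.normSq r + Quaternion.normSq p * Quaternion.normSq s -
        2 * (r * star s * q * star p).re : ℝ) : Quaternion ℝ) := by
    intro p q r s
    have h1 : star q * s * star r * p + star p * r * star s * q =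
        ((2 * (r * star s * q * star p).re : ℝ) : Quaternion ℝ) := by
      rw [Quaternion.re_mul_comm, ← mul_assoc, ← mul_assoc, ← Quaternion.self_add_star']
      simp only [star_mul, star_star, mul_assoc]
      abel
    rw [Quaternion.coe_sub, ← h1, sub_mul, sub_mul, smul_mul_assoc, smul_mul_assoc,
      Quaternion.star_mul_self, Quaternion.star_mul_self, ← Quaternion.coe_smul,
      ← Quaternion.coe_smul, Quaternion.coe_add, smul_eq_mul, smul_eq_mul,
      mul_comm (Quaternion.normSq r), mul_comm (Quaternion.normSq s)]
    abel
  have hoff : ∀ p q r s : Quaternion ℝ,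
      (Quaternion.normSq s • star p - star q * s * star r) * r +
      (Quaternion.normSq r • star q - star p * r * star s) * s = 0 := by
    intro p q r s
    rw [sub_mul, sub_mul, Quaternion.mul_star_mul_self, Quaternion.mul_star_mul_self,
      smul_mul_assoc, smul_mul_assoc]
    abel
  have h' : Quaternion.normSq s * Quaternion.normSq p + Quaternion.normSq r * Quaternion.normSq q -
      2 * (p * star q * s * star r).re = 1 := by
    have : (p * star q * s * star r).re = (r * star s * q * star p).re := by
      rw [← Quaternion.re_star]
      simp only [star_mul, star_star, mul_assoc]
    rw [this]
    linarith
  rw [Matrix.mul_fin_two, Matrix.one_fin_two, hdiag, hoff, h, hoff r s p q, hdiag r s p q, h',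
    Quaternion.coe_one]

theorem ne_zero_of_mem_admissiblePairs {pq : O' × O'} (h : pq ∈ admissiblePairs I') :
    (pq.2 : Quaternion ℝ) ≠ 0 := by
  intro h0
  obtain ⟨-, r, s, h1⟩ := h
  simp [h0] at h1

theorem exists_mem_cuspSubgroup {hO : ∀ x ∈ O', x ≠ 0 → 1 ≤ ‖x‖} (hstar : ∀ x ∈ O', star x ∈ O')
    {pq : O' × O'} (h : pq ∈ admissiblePairs I') :
    ∃ g ∈ cuspSubgroup hO I', g.1 0 0 = pq.1 ∧ g.1 1 0 = pq.2 := by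
  have hq := ne_zero_of_mem_admissiblePairs h
  obtain ⟨⟨p, hp⟩, ⟨q, hqO⟩⟩ := pq
  obtain ⟨hqI, ⟨r, hr⟩, ⟨s, hs⟩, h1⟩ := h
  simp only at hq h1 ⊢
  have hqI' : q ∈ idealSet I' := ⟨_, hqI, rfl⟩
  have hinv := adjugate_mul_eq_one ((normSq_dieudonne hq).symm.trans h1)
  have hmem : ∀ x ∈ O', ∀ y ∈ O', Quaternion.normSq x • y ∈ O' := fun x hx y hy => by
    rw [← Quaternion.mul_star_mul_self]
    exact O'.mul_mem (O'.mul_mem hy (hstar x hx)) hx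
  let g : (Matrix (Fin 2) (Fin 2) (Quaternion ℝ))ˣ := ⟨_, _, mul_eq_one_comm.1 hinv, hinv⟩
  have hschur := inv_lowerLeft_mul_schur (g := g) hq
  refine ⟨g, ?_, rfl, rfl⟩
  exact {
    mem := by
      intro i j
      fin_cases i <;> fin_cases j <;> simpa [g]
    lowerLeft_mem := hqI'
    mem_inv := by
      intro i j
      fin_cases i <;> fin_cases j <;>
        exact O'.sub_mem (hmem _ ‹_› _ (hstar _ ‹_›))
          (O'.mul_mem (O'.mul_mem (hstar _ ‹_›) ‹_›) (hstar _ ‹_›))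
    lowerLeft_inv_mem := by
      refine sub_mem_idealSet ?_
        (mul_mem_idealSet_right (mul_mem_idealSet_left (hstar _ hs) hqI') (hstar _ hp))
      rw [← Quaternion.mul_star_mul_self]
      exact mul_mem_idealSet_left (O'.mul_mem (hstar _ hr) (hstar _ hqO)) hqI'
    norm_lowerLeft := by
      have e1 : q * r - q * p * q⁻¹ * s = q * (r - p * q⁻¹ * s) := by
        rw [mul_sub]; simp only [mul_assoc]
      rw [e1, Quaternion.normSq_eq_norm_mul_self, norm_mul] at h1
      have e2 := congrArg norm hschur
      rw [norm_mul, norm_one] at e2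
      change ‖(g⁻¹).1 1 0‖ * ‖r - p * q⁻¹ * s‖ = 1 at e2
      change ‖q‖ = _
      have e3 : ‖q‖ * ‖r - p * q⁻¹ * s‖ = 1 :=
        (mul_self_eq_one_iff.1 h1).resolve_right fun h => by
          have : 0 ≤ ‖q‖ * ‖r - p * q⁻¹ * s‖ := by positivity
          linarith
      exact mul_right_cancel₀ (right_ne_zero_of_mul_eq_one e2) (e3.trans e2.symm) }

theorem exists_mem_admissiblePairs {hO : ∀ x ∈ O', x ≠ 0 → 1 ≤ ‖x‖}
    {g : (Matrix (Fin 2) (Fin 2) (Quaternion ℝ))ˣ} (hg : g ∈ cuspSubgroup hO I')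
    (hc : g.1 1 0 ≠ 0) :
    ∃ pq ∈ admissiblePairs I', g.1 0 0 = (pq.1 : Quaternion ℝ) ∧ g.1 1 0 = pq.2 := by
  have hg : IsCuspMatrix I' g := hg
  obtain ⟨q, hqI, hq⟩ := hg.lowerLeft_mem
  refine ⟨(⟨_, hg.mem 0 0⟩, q), ⟨hqI, ⟨_, hg.mem 0 1⟩, ⟨_, hg.mem 1 1⟩, ?_⟩, rfl, hq.symm⟩
  have e2 := congrArg norm (inv_lowerLeft_mul_schur hc)
  rw [norm_mul, norm_one, ← hg.norm_lowerLeft, ← norm_mul] at e2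
  have e1 : (q : Quaternion ℝ) * g.1 0 1 - q * g.1 0 0 * (q : Quaternion ℝ)⁻¹ * g.1 1 1 =
      g.1 1 0 * (g.1 0 1 - moebInf g.1 * g.1 1 1) := by
    rw [hq, mul_sub, moebInf]; simp only [mul_assoc]
  simp only
  rw [e1, Quaternion.normSq_eq_norm_mul_self, e2, one_mul]

end AdmissiblePairs

section Spectrum

variable {O' : Subring (Quaternion ℝ)}

/-- The quantity `N(q) N(x - p q⁻¹) ^ (1 / 2)` measuring the approximation of `x` by `p q⁻¹`. -/
noncomputable def approxError (x : Quaternion ℝ) (pq : O' × O') : ℝ :=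
  Quaternion.normSq (pq.2 : Quaternion ℝ) *
    Real.sqrt (Quaternion.normSq (x - (pq.1 : Quaternion ℝ) * (pq.2 : Quaternion ℝ)⁻¹))

/-- The filter of admissible pairs `(p, q)` with `N(q)` tending to infinity. -/
def denomFilter (I' : TwoSidedIdeal O') : Filter (O' × O') :=
  𝓟 (admissiblePairs I') ⊓
    comap (fun pq : O' × O' => Quaternion.normSq (pq.2 : Quaternion ℝ)) atTop

variable {I' : TwoSidedIdeal O'}

theorem approxError_eq (x : Quaternion ℝ) (pq : O' × O') :
    approxError x pq = ‖(pq.2 : Quaternion ℝ)‖ *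
      (‖(pq.2 : Quaternion ℝ)‖ * ‖x - (pq.1 : Quaternion ℝ) * (pq.2 : Quaternion ℝ)⁻¹‖) := by
  rw [approxError, Quaternion.normSq_eq_norm_mul_self, Quaternion.normSq_eq_norm_mul_self,
    Real.sqrt_mul_self (norm_nonneg _), mul_assoc]

theorem approxError_nonneg (x : Quaternion ℝ) (pq : O' × O') : 0 ≤ approxError x pq := by
  rw [approxError_eq]
  positivity

theorem eventually_denomFilter {P : O' × O' → Prop} :
    (∀ᶠ pq in denomFilter I', P pq) ↔
      ∃ T : ℝ, ∀ pq ∈ admissiblePairs I', T ≤ ‖(pq.2 : Quaternion ℝ)‖ → P pq := by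
  rw [denomFilter, inf_comm, eventually_inf_principal, eventually_comap, eventually_atTop]
  constructor
  · rintro ⟨a, ha⟩
    refine ⟨max a 1, fun pq hpq hT => ha _ ?_ pq rfl hpq⟩
    rw [Quaternion.normSq_eq_norm_mul_self]
    have h1 := (le_max_left a 1).trans hT
    have h2 := (le_max_right a 1).trans hT
    exact h1.trans (le_mul_of_one_le_left (norm_nonneg _) h2)
  · rintro ⟨T, hT⟩
    refine ⟨T ^ 2, fun y hy pq hpq hE => hT pq hE ?_⟩
    rw [← hpq, Quaternion.normSq_eq_norm_mul_self, ← sq] at hy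
    exact (abs_le_of_sq_le_sq' hy (norm_nonneg _)).2

theorem frequently_denomFilter {P : O' × O' → Prop} :
    (∃ᶠ pq in denomFilter I', P pq) ↔
      ∀ T : ℝ, ∃ pq ∈ admissiblePairs I', T ≤ ‖(pq.2 : Quaternion ℝ)‖ ∧ P pq := by
  rw [Filter.Frequently, eventually_denomFilter]
  push Not
  rfl

theorem exists_cuspDist_eq_approxError {hO : ∀ x ∈ O', x ≠ 0 → 1 ≤ ‖x‖}
    (hstar : ∀ x ∈ O', star x ∈ O') {pq : O' × O'} (h : pq ∈ admissiblePairs I')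
    (x : Quaternion ℝ) :
    ∃ g ∈ cuspSubgroup hO I', ‖g.1 1 0‖ = ‖(pq.2 : Quaternion ℝ)‖ ∧
      cuspDist g.1 x = approxError x pq := by
  obtain ⟨g, hg, h0, h1⟩ := exists_mem_cuspSubgroup (hO := hO) hstar h
  have hg' : IsCuspMatrix I' g := hg
  have hn := hg'.norm_lowerLeft
  have hc : g.1 1 0 ≠ 0 := by rw [h1]; exact ne_zero_of_mem_admissiblePairs h
  refine ⟨g⁻¹, inv_mem hg, by rw [← hn, h1], ?_⟩
  rw [cuspDist, norm_moebDen_inv hn hc, ← hn, approxError_eq, moebInf, h0, h1]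

theorem exists_approxError_eq_cuspDist {hO : ∀ x ∈ O', x ≠ 0 → 1 ≤ ‖x‖}
    {g : (Matrix (Fin 2) (Fin 2) (Quaternion ℝ))ˣ} (hg : g ∈ cuspSubgroup hO I')
    (hc : g.1 1 0 ≠ 0) (x : Quaternion ℝ) :
    ∃ pq ∈ admissiblePairs I', ‖(pq.2 : Quaternion ℝ)‖ = ‖g.1 1 0‖ ∧
      approxError x pq = cuspDist g.1 x := by
  have hg' : IsCuspMatrix I' g⁻¹ := inv_mem (S := Subgroup _) hg
  have hn := hg'.norm_lowerLeft
  have hc' : (g⁻¹).1 1 0 ≠ 0 := by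
    rw [← norm_ne_zero_iff, hn, inv_inv]
    exact norm_ne_zero_iff.2 hc
  obtain ⟨pq, hpq, h0, h1⟩ := exists_mem_admissiblePairs (hO := hO) (inv_mem hg) hc'
  have h2 := norm_moebDen_inv hn hc' x
  rw [inv_inv] at hn h2
  refine ⟨pq, hpq, by rw [← hn, h1], ?_⟩
  rw [cuspDist, h2, ← hn, approxError_eq, moebInf, h0, h1]

theorem isAlmostCuspLiminf_iff {hO : ∀ x ∈ O', x ≠ 0 → 1 ≤ ‖x‖}
    (hstar : ∀ x ∈ O', star x ∈ O') {c ε : ℝ} {x : Quaternion ℝ} :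
    IsAlmostCuspLiminf (cuspSubgroup hO I') c ε x ↔
      (∀ᶠ pq in denomFilter I', c - ε ≤ approxError x pq) ∧
        ∃ᶠ pq in denomFilter I', approxError x pq ≤ c + ε := by
  rw [eventually_denomFilter, frequently_denomFilter, IsAlmostCuspLiminf]
  have hpos : ∀ {T : ℝ} {g : (Matrix (Fin 2) (Fin 2) (Quaternion ℝ))ˣ},
      max T 1 ≤ ‖g.1 1 0‖ → g.1 1 0 ≠ 0 := fun h =>
    norm_pos_iff.1 (one_pos.trans_le ((le_max_right _ _).trans h))
  constructor
  · rintro ⟨⟨T, hT⟩, hF⟩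
    refine ⟨⟨T, fun pq hpq hle => ?_⟩, fun T => ?_⟩
    · obtain ⟨g, hg, h1, h2⟩ := exists_cuspDist_eq_approxError (hO := hO) hstar hpq x
      rw [← h2]
      exact hT g hg (by rwa [h1])
    · obtain ⟨g, hg, h1, h2⟩ := hF (max T 1)
      obtain ⟨pq, hpq, h3, h4⟩ := exists_approxError_eq_cuspDist hg (hpos h1) x
      exact ⟨pq, hpq, h3 ▸ (le_max_left _ _).trans h1, h4 ▸ h2⟩
  · rintro ⟨⟨T, hT⟩, hF⟩
    refine ⟨⟨max T 1, fun g hg hle => ?_⟩, fun T => ?_⟩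
    · obtain ⟨pq, hpq, h3, h4⟩ := exists_approxError_eq_cuspDist hg (hpos hle) x
      rw [← h4]
      exact hT pq hpq (h3 ▸ (le_max_left _ _).trans hle)
    · obtain ⟨pq, hpq, h1, h2⟩ := hF T
      obtain ⟨g, hg, h3, h4⟩ := exists_cuspDist_eq_approxError (hO := hO) hstar hpq x
      exact ⟨g, hg, h3 ▸ h1, h4 ▸ h2⟩

theorem eventually_and_frequently_of_liminf_pos {α : Type*} {F : Filter α} {u : α → ℝ} {ε : ℝ}
    (hpos : 0 < liminf u F) (hε : 0 < ε) :
    (∀ᶠ a in F, liminf u F - ε ≤ u a) ∧ ∃ᶠ a in F, u a ≤ liminf u F + ε := by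
  rw [liminf_eq] at *
  set S := {a | ∀ᶠ n in F, a ≤ u n} with hS
  have hbdd : BddAbove S := by
    by_contra h
    exact hpos.ne' (Real.sSup_of_not_bddAbove h)
  have hne : S.Nonempty := by
    by_contra h
    rw [Set.not_nonempty_iff_eq_empty] at h
    exact hpos.ne' (by rw [h, Real.sSup_empty])
  refine ⟨?_, fun h => ?_⟩
  · obtain ⟨a, ha, hlt⟩ := exists_lt_of_lt_csSup hne (sub_lt_self _ hε)
    exact ha.mono fun n hn => hlt.le.trans hn
  · have : sSup S + ε ∈ S := h.mono fun n hn => (not_le.1 hn).le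
    linarith [le_csSup hbdd this]

theorem liminf_eq_of_eventually_of_frequently {α : Type*} {F : Filter α} {u : α → ℝ} {c : ℝ}
    (h : ∀ ε > 0, (∀ᶠ a in F, c - ε ≤ u a) ∧ ∃ᶠ a in F, u a ≤ c + ε) : liminf u F = c := by
  rw [liminf_eq]
  have hub : ∀ a ∈ {a | ∀ᶠ n in F, a ≤ u n}, a ≤ c := fun a ha =>
    le_of_forall_pos_le_add fun ε hε => by
      obtain ⟨n, h1, h2⟩ := ((h ε hε).2.and_eventually ha).exists
      exact h2.trans h1
  refine le_antisymm (csSup_le ⟨c - 1, (h 1 one_pos).1⟩ hub)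
    (le_of_forall_sub_le fun ε hε => le_csSup ⟨c, hub⟩ (h ε hε).1)

theorem liminf_approxError_nonneg (x : Quaternion ℝ) :
    0 ≤ liminf (approxError x) (denomFilter I') := by
  rw [liminf_eq]
  by_cases h : BddAbove {a | ∀ᶠ pq in denomFilter I', a ≤ approxError x pq}
  · exact le_csSup h (Set.mem_ofPred.2 (Eventually.of_forall (approxError_nonneg x)))
  · rw [Real.sSup_of_not_bddAbove h]

/-- Points with positive approximation constant are irrational. -/
theorem notMem_of_isAlmostCuspLiminf {hO : ∀ x ∈ O', x ≠ 0 → 1 ≤ ‖x‖} {c : ℝ} (hc : 0 < c)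
    {x : Quaternion ℝ} (hx : ∀ ε > 0, IsAlmostCuspLiminf (cuspSubgroup hO I') c ε x) {m : ℤ}
    (hm : m ≠ 0) : (m : Quaternion ℝ) * x ∉ O' := by
  intro hmx
  obtain ⟨⟨T, hT⟩, hF⟩ := hx (c / 2) (half_pos hc)
  have hm' : 0 < ‖(m : Quaternion ℝ)‖ := by
    rw [← Quaternion.coe_intCast, Quaternion.norm_coe]
    exact norm_pos_iff.2 (Int.cast_ne_zero.2 hm)
  obtain ⟨g, hg, h1, h2⟩ := hF (max T (‖(m : Quaternion ℝ)‖ * (2 * c)))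
  have h3 := hT g hg ((le_max_left _ _).trans h1)
  have h4 := (le_max_right _ _).trans h1
  obtain ⟨hc0, hd0⟩ := ne_zero_of_cuspDist_pos (lt_of_lt_of_le (by linarith) h3)
  have hg' : IsCuspMatrix I' g := hg
  have e : (m : Quaternion ℝ) * moebDen g.1 x = g.1 1 0 * (m * x) + m * g.1 1 1 := by
    rw [moebDen, mul_add, ← mul_assoc, ← mul_assoc, (Int.cast_commute m (g.1 1 0)).eq]
  have h5 : 1 ≤ ‖(m : Quaternion ℝ) * moebDen g.1 x‖ := by
    refine hO _ ?_ (mul_ne_zero (norm_pos_iff.1 hm') hd0)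
    rw [e]
    exact O'.add_mem (O'.mul_mem (hg'.mem 1 0) hmx) (O'.mul_mem (intCast_mem O' m) (hg'.mem 1 1))
  rw [norm_mul] at h5
  have hc1 : 0 < ‖g.1 1 0‖ := norm_pos_iff.2 hc0
  have h6 : ‖g.1 1 0‖ ≤ ‖(m : Quaternion ℝ)‖ * (‖g.1 1 0‖ * ‖moebDen g.1 x‖) := by
    calc ‖g.1 1 0‖ ≤ ‖g.1 1 0‖ * (‖(m : Quaternion ℝ)‖ * ‖moebDen g.1 x‖) :=
          le_mul_of_one_le_right hc1.le h5
      _ = _ := by ring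
  have h7 : ‖(m : Quaternion ℝ)‖ * (‖g.1 1 0‖ * ‖moebDen g.1 x‖) ≤
      ‖(m : Quaternion ℝ)‖ * (c + c / 2) := mul_le_mul_of_nonneg_left h2 hm'.le
  nlinarith [mul_pos hm' hc]

theorem exists_nat_mem_idealSet {b : Module.Basis (Fin 4) ℝ (Quaternion ℝ)}
    (hb : ∀ x, x ∈ O' ↔ x ∈ Submodule.span ℤ (Set.range b)) (hI' : I' ≠ ⊥) :
    ∃ M : ℕ, 2 ≤ M ∧ (M : Quaternion ℝ) ∈ idealSet I' := by
  obtain ⟨q, hqI, hq0⟩ : ∃ q ∈ I', q ≠ 0 := by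
    by_contra! h
    exact hI' (le_bot_iff.1 fun x hx => (TwoSidedIdeal.mem_bot _).2 (h x hx))
  have hN : ((Quaternion.normSq (q : Quaternion ℝ) : ℝ) : Quaternion ℝ) ∈ idealSet I' := by
    rw [← Quaternion.star_mul_self]
    exact mul_mem_idealSet_left (star_mem_order hb q.2) ⟨q, hqI, rfl⟩
  obtain ⟨m, hm⟩ := exists_int_eq_of_coe_mem_order hb (mem_of_mem_idealSet hN)
  have hpos : 0 < Quaternion.normSq (q : Quaternion ℝ) :=
    lt_of_le_of_ne Quaternion.normSq_nonneg
      (Quaternion.normSq_ne_zero.2 fun h => hq0 (Subtype.ext h)).symm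
  rw [hm, Int.cast_pos] at hpos
  lift m to ℕ using hpos.le
  refine ⟨m + m, by omega, ?_⟩
  rw [hm, Int.cast_natCast, Quaternion.coe_natCast] at hN
  rw [Nat.cast_add]
  exact add_mem_idealSet hN hN

theorem mem_admissiblePairs_of_isCoprime {p q : ℤ} (hpq : IsCoprime p q) (hq0 : q ≠ 0)
    (hq : (q : Quaternion ℝ) ∈ idealSet I') : ((p : O'), (q : O')) ∈ admissiblePairs I' := by
  obtain ⟨u, v, huv⟩ := hpq
  obtain ⟨q', hq'I, hq'⟩ := hq
  have : q' = (q : O') := Subtype.ext (by rw [hq', SubringClass.coe_intCast])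
  refine ⟨this ▸ hq'I, (v : O'), ((-u : ℤ) : O'), ?_⟩
  have hq1 : (q : Quaternion ℝ) ≠ 0 := by
    rw [← Quaternion.coe_intCast, ← Quaternion.coe_zero, Ne, Quaternion.coe_inj]
    exact Int.cast_ne_zero.2 hq0
  simp only [SubringClass.coe_intCast]
  rw [(Int.cast_commute q (p : Quaternion ℝ)).eq, mul_inv_cancel_right₀ hq1, ← Int.cast_mul,
    ← Int.cast_mul, ← Int.cast_sub]
  have : q * v - p * -u = 1 := by linarith
  rw [this, Int.cast_one, map_one]

open Nat in
theorem exists_isCoprime_liouvilleNumber {M : ℕ} (hM : 2 ≤ M) {k : ℕ} (hk : 2 ≤ k) :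
    ∃ p : ℤ, IsCoprime p ((M : ℤ) ^ k !) ∧
      |liouvilleNumber M - p / ((M : ℝ) ^ k !)| < 1 / ((M : ℝ) ^ k !) ^ k := by
  obtain ⟨j, rfl⟩ : ∃ j, k = j + 1 := ⟨k - 1, by omega⟩
  have hM0 : 0 < M := by omega
  have hM1 : (1 : ℝ) < M := by exact_mod_cast hM
  obtain ⟨p, hp⟩ := LiouvilleNumber.partialSum_eq_rat hM0 j
  obtain ⟨d, hd⟩ : ∃ d, (j + 1)! = j ! + (d + 1) := by
    have : j ! < (j + 1)! := Nat.factorial_lt_of_lt (by omega) (by omega)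
    exact ⟨(j + 1)! - (j !) - 1, by omega⟩
  refine ⟨(p * M ^ d) * M + 1, ?_, ?_⟩
  · refine IsCoprime.pow_right ⟨1, -(p * M ^ d), by ring⟩
  · have e : (((p * M ^ d * M + 1 : ℤ) : ℝ)) / (M : ℝ) ^ (j + 1)! =
        LiouvilleNumber.partialSum M (j + 1) := by
      have : (M : ℝ) ≠ 0 := by positivity
      rw [LiouvilleNumber.partialSum_succ, hp, hd]
      push_cast
      field_simp
      ring
    rw [e, ← LiouvilleNumber.partialSum_add_remainder hM1 (j + 1), add_sub_cancel_left,
      abs_of_pos (LiouvilleNumber.remainder_pos hM1 _)]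
    exact LiouvilleNumber.remainder_lt _ (by exact_mod_cast hM)

open Nat in
theorem liminf_approxError_liouvilleNumber {M : ℕ} (hM : 2 ≤ M)
    (hMI : (M : Quaternion ℝ) ∈ idealSet I') :
    liminf (approxError ((liouvilleNumber M : ℝ) : Quaternion ℝ)) (denomFilter I') = 0 := by
  refine liminf_eq_of_eventually_of_frequently fun ε hε =>
    ⟨Eventually.of_forall fun pq => ?_, frequently_denomFilter.2 fun T => ?_⟩
  · linarith [approxError_nonneg ((liouvilleNumber M : ℝ) : Quaternion ℝ) pq]
  obtain ⟨n, hn⟩ := exists_nat_ge (max T ε⁻¹)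
  set k := n + 3 with hk
  obtain ⟨p, hcop, hlt⟩ := exists_isCoprime_liouvilleNumber hM (k := k) (by omega)
  set Q : ℝ := (M : ℝ) ^ k ! with hQ
  have hnQ : (n : ℝ) ≤ Q := by
    have h1 : n ≤ k ! := by linarith [Nat.self_le_factorial k]
    have h2 : k ! < M ^ k ! := Nat.lt_pow_self (by omega)
    rw [hQ]
    exact_mod_cast (h1.trans h2.le)
  have hTQ : T ≤ Q := (le_max_left _ _).trans (hn.trans hnQ)
  have hεQ : ε⁻¹ ≤ Q := (le_max_right _ _).trans (hn.trans hnQ)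
  have hQ0 : 0 < Q := (inv_pos.2 hε).trans_le hεQ
  have hQ1 : 1 ≤ Q := one_le_pow₀ (by exact_mod_cast (by omega : 1 ≤ M))
  have hMpow : (((M : ℤ) ^ k ! : ℤ) : Quaternion ℝ) ∈ idealSet I' := by
    obtain ⟨f, hf⟩ : ∃ f, k ! = f + 1 := ⟨(k !) - 1, by have := Nat.factorial_pos k; omega⟩
    rw [hf, pow_succ, Int.cast_mul, Int.cast_natCast]
    exact mul_mem_idealSet_left (intCast_mem O' _) hMI
  have hZ0 : ((M : ℤ) ^ k !) ≠ 0 := pow_ne_zero _ (by omega)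
  refine ⟨_, mem_admissiblePairs_of_isCoprime hcop hZ0 hMpow, ?_⟩
  have eQ : ((((M : ℤ) ^ k ! : ℤ) : O') : Quaternion ℝ) = ((Q : ℝ) : Quaternion ℝ) := by
    rw [SubringClass.coe_intCast, ← Quaternion.coe_intCast, hQ]
    push_cast
    rfl
  have ep : ((p : O') : Quaternion ℝ) = ((p : ℝ) : Quaternion ℝ) := by
    rw [SubringClass.coe_intCast, Quaternion.coe_intCast]
  rw [approxError_eq]
  simp only [eQ, ep]
  rw [← Quaternion.coe_inv, ← Quaternion.coe_mul, ← Quaternion.coe_sub, Quaternion.norm_coe,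
    Quaternion.norm_coe, Real.norm_of_nonneg hQ0.le, Real.norm_eq_abs, ← div_eq_mul_inv]
  refine ⟨hTQ, ?_⟩
  calc Q * (Q * |liouvilleNumber M - p / Q|) ≤ Q * (Q * (1 / Q ^ k)) := by gcongr
    _ = 1 / Q ^ (n + 1) := by
      rw [hk]
      field_simp
      ring
    _ ≤ 1 / Q := by
      refine one_div_le_one_div_of_le hQ0 ?_
      exact le_self_pow₀ hQ1 (by omega)
    _ ≤ 0 + ε := by
      rw [zero_add, one_div]
      exact inv_le_of_inv_le₀ hε hεQ

theorem liouvilleNumber_mul_notMem {b : Module.Basis (Fin 4) ℝ (Quaternion ℝ)}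
    (hb : ∀ x, x ∈ O' ↔ x ∈ Submodule.span ℤ (Set.range b)) {M : ℕ} (hM : 2 ≤ M) {m : ℤ}
    (hm : m ≠ 0) : (m : Quaternion ℝ) * ((liouvilleNumber M : ℝ) : Quaternion ℝ) ∉ O' := by
  intro h
  rw [← Quaternion.coe_intCast, ← Quaternion.coe_mul] at h
  obtain ⟨n, hn⟩ := exists_int_eq_of_coe_mem_order hb h
  exact (((liouville_liouvilleNumber hM).irrational).intCast_mul hm).ne_int n hn

end Spectrum

/-- The Hamilton–Lagrange spectrum is closed.  Here the quaternion algebra `A` over `ℚ`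
ramified over `ℝ` is realized, via a fixed identification `A(ℝ) ≅ ℍ`, as a `ℚ`-subalgebra
of Hamilton's quaternions `ℍ = Quaternion ℝ` of dimension `4` over `ℚ` which spans `ℍ`
over `ℝ`; the reduced norm `N` is `Quaternion.normSq`.  `O'` is an order in `A`
(a subring of `A`, finitely generated as a `ℤ`-module, spanning `A` over `ℚ`),
`I'` is a nonzero two-sided ideal of `O'`,
`E_{I'} = {(p,q) ∈ O' × I' : ∃ r s ∈ O', N(qr - qpq⁻¹s) = 1}`, and for
`x ∈ ℍ \ A`, `c_{I'}(x) = liminf_{(p,q) ∈ E_{I'}, N(q) → ∞} N(q) √(N(x - pq⁻¹))`. -/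
theorem hamilton_lagrange_spectrum_isClosed
    (A : Subalgebra ℚ (Quaternion ℝ))
    (hAdim : Module.finrank ℚ A = 4)
    (hAspan : Submodule.span ℝ (A : Set (Quaternion ℝ)) = ⊤)
    (O' : Subring (Quaternion ℝ))
    (hO'A : (O' : Set (Quaternion ℝ)) ⊆ A)
    (hO'fg : ∃ s : Finset (Quaternion ℝ), ↑s ⊆ (O' : Set (Quaternion ℝ)) ∧
      ∀ x ∈ O', x ∈ Submodule.span ℤ (s : Set (Quaternion ℝ)))
    (hO'span : ∀ x ∈ A, x ∈ Submodule.span ℚ (O' : Set (Quaternion ℝ)))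
    (I' : TwoSidedIdeal O') (hI' : I' ≠ ⊥) :
    IsClosed { c : ℝ | ∃ x : Quaternion ℝ, x ∉ A ∧
      c = Filter.liminf
            (fun pq : O' × O' =>
              Quaternion.normSq ((pq.2 : Quaternion ℝ)) *
                Real.sqrt (Quaternion.normSq
                  (x - (pq.1 : Quaternion ℝ) * (pq.2 : Quaternion ℝ)⁻¹)))
            (Filter.principal {pq : O' × O' | pq.2 ∈ I' ∧
                ∃ r s : O', Quaternion.normSq
                  ((pq.2 : Quaternion ℝ) * (r : Quaternion ℝ) -
                    (pq.2 : Quaternion ℝ) * (pq.1 : Quaternion ℝ) *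
                      (pq.2 : Quaternion ℝ)⁻¹ * (s : Quaternion ℝ)) = 1} ⊓
              Filter.comap
                (fun pq : O' × O' => Quaternion.normSq ((pq.2 : Quaternion ℝ)))
                Filter.atTop) } := by
  obtain ⟨b, hb⟩ := exists_basis_mem_iff_mem_span_int A hAdim hAspan O' hO'A hO'fg hO'span
  have hO : ∀ x ∈ O', x ≠ 0 → 1 ≤ ‖x‖ := fun x => one_le_norm_of_mem_order hb
  have hstar : ∀ x ∈ O', star x ∈ O' := fun x => star_mem_order hb
  have hA : ∀ x, (∀ m : ℤ, m ≠ 0 → (m : Quaternion ℝ) * x ∉ O') → x ∉ A := fun x hx hxA => by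
    obtain ⟨m, hm, hmx⟩ := exists_int_smul_mem_order (hO'span x hxA)
    exact hx m hm hmx
  change IsClosed {c : ℝ | ∃ x : Quaternion ℝ, x ∉ A ∧
    c = liminf (approxError x) (denomFilter I')}
  refine isClosed_of_closure_subset fun c hc => ?_
  rw [Metric.mem_closure_iff] at hc
  have hc0 : 0 ≤ c := by
    by_contra! hneg
    obtain ⟨_, ⟨x, -, rfl⟩, hx⟩ := hc (-c) (neg_pos.2 hneg)
    rw [Real.dist_eq] at hx
    linarith [neg_le_abs (c - liminf (approxError x) (denomFilter I')),
      liminf_approxError_nonneg (I' := I') x]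
  obtain rfl | hpos := hc0.eq_or_lt
  · obtain ⟨M, hM, hMI⟩ := exists_nat_mem_idealSet hb hI'
    exact ⟨_, hA _ fun m hm => liouvilleNumber_mul_notMem hb hM hm,
      (liminf_approxError_liouvilleNumber hM hMI).symm⟩
  have H : ∀ ε > 0, ∃ x, IsAlmostCuspLiminf (cuspSubgroup hO I') c ε x := by
    intro ε hε
    obtain ⟨_, ⟨x, -, rfl⟩, hx⟩ := hc (min (ε / 2) c) (lt_min (half_pos hε) hpos)
    rw [Real.dist_eq, lt_min_iff] at hx
    have h1 := abs_lt.1 hx.1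
    have h2 := abs_lt.1 hx.2
    obtain ⟨h3, h4⟩ := eventually_and_frequently_of_liminf_pos
      (u := approxError x) (F := denomFilter I') (by linarith) (half_pos hε)
    exact ⟨x, (isAlmostCuspLiminf_iff hstar).2
      ⟨h3.mono fun _ h => by linarith, h4.mono fun _ h => by linarith⟩⟩
  obtain ⟨x, hx⟩ := exists_isAlmostCuspLiminf isCuspGroup_cuspSubgroup
    (hasTranslations_cuspSubgroup hb) hpos H
  exact ⟨x, hA x fun m hm => notMem_of_isAlmostCuspLiminf hpos hx hm,
    (liminf_eq_of_eventually_of_frequently fun ε hε =>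
      (isAlmostCuspLiminf_iff hstar).1 (hx ε hε)).symm⟩
end
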